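/- arXiv:2409.20088 — 3 statements merged into one kernel-verified Lean document; each statement's English description precedes it below -/
import Mathlib

section
/- Suppose char K = 2 and φ ∈ O(V,Q) is of type 1e. Then there exist η ∈ O(V,Q) and s ∈ O(V,Q) such that η is cyclic, s is a semisimple endomorphism of V, s commutes with φ, and η = φ ∘ s; that is, φ is the unipotent factor in the multiplicative Jordan–Chevalley decomposition of a cyclic transformation in O(V,Q). -/
open Polynomial Module

variable {K V : Type*}

section Defs

variable [Field K] [AddCommGroup V] [Module K V]

/-- The polar form `f_Q(u,w) = Q(u+w) - Q u - Q w` of a quadratic form. -/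
def polarF (Q : QuadraticForm K V) (u w : V) : K := Q (u + w) - Q u - Q w

/-- `Q` is nondefective: its polar form is nondegenerate. -/
def Nondefective (Q : QuadraticForm K V) : Prop :=
  ∀ u : V, (∀ w : V, polarF Q u w = 0) → u = 0

/-- Membership in the orthogonal group `O(V,Q)`. -/
def InO (Q : QuadraticForm K V) (φ : V ≃ₗ[K] V) : Prop := ∀ v : V, Q (φ v) = Q v

/-- Membership in the special orthogonal group `SO(V,Q)`:
orthogonal and `dim im(φ - 1)` is even. -/
def InSO (Q : QuadraticForm K V) (φ : V ≃ₗ[K] V) : Prop :=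
  InO Q φ ∧ Even (Module.finrank K (LinearMap.range (φ.toLinearMap - LinearMap.id)))

/-- `φ` is a product of two involutions of `SO(V,Q)`. -/
def BireflSO (Q : QuadraticForm K V) (φ : V ≃ₗ[K] V) : Prop :=
  ∃ σ τ : V ≃ₗ[K] V, InSO Q σ ∧ InSO Q τ ∧ σ * σ = 1 ∧ τ * τ = 1 ∧ φ = σ * τ

/-- A subspace is totally isotropic if `Q` vanishes on it. -/
def TotIsotropic (Q : QuadraticForm K V) (U : Submodule K V) : Prop := ∀ u ∈ U, Q u = 0

/-- A subspace invariant under a linear map. -/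
def Invariant (f : V →ₗ[K] V) (U : Submodule K V) : Prop := ∀ u ∈ U, f u ∈ U

/-- The restriction of the polar form of `Q` to `U` is nondegenerate. -/
def NondegOn (Q : QuadraticForm K V) (U : Submodule K V) : Prop :=
  ∀ u ∈ U, (∀ w ∈ U, polarF Q u w = 0) → u = 0

/-- `f` is orthogonally indecomposable: no invariant subspace `W` with
`0 < dim W < dim V` on which the polar form of `Q` is nondegenerate. -/
def OrthIndec (Q : QuadraticForm K V) (f : V →ₗ[K] V) : Prop :=
  ¬ ∃ W : Submodule K V, Invariant f W ∧ 0 < Module.finrank K W ∧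
      Module.finrank K W < Module.finrank K V ∧ NondegOn Q W

/-- The subspace spanned by the `f`-orbit of `x`. -/
def cyclicSpan (f : V →ₗ[K] V) (x : V) : Submodule K V :=
  Submodule.span K (Set.range fun k : ℕ => (f ^ k) x)

/-- `f` is a cyclic linear map. -/
def IsCyclicEnd (f : V →ₗ[K] V) : Prop := ∃ x : V, cyclicSpan f x = ⊤

/-- `f` is of type 1 with exponent `m`: orthogonally indecomposable, bicyclic, and
with minimal polynomial `(X - 1) ^ m`. -/
def IsType1 (Q : QuadraticForm K V) (f : V →ₗ[K] V) (m : ℕ) : Prop :=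
  OrthIndec Q f ∧ 1 ≤ m ∧ minpoly K f = (X - 1) ^ m ∧
    ∃ x z : V, IsCompl (cyclicSpan f x) (cyclicSpan f z)

/-- Type 1o: type 1 with odd exponent. -/
def IsType1o (Q : QuadraticForm K V) (f : V →ₗ[K] V) : Prop :=
  ∃ m : ℕ, IsType1 Q f m ∧ Odd m

/-- Type 1e: type 1 with even exponent. -/
def IsType1e (Q : QuadraticForm K V) (f : V →ₗ[K] V) : Prop :=
  ∃ m : ℕ, IsType1 Q f m ∧ Even m

/-- The quadratic space `(V,Q)` is hyperbolic. -/
def HyperbolicSpace (Q : QuadraticForm K V) : Prop :=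
  ∃ U W : Submodule K V, TotIsotropic Q U ∧ TotIsotropic Q W ∧ IsCompl U W

/-- The transformation `f` is hyperbolic: `V` is a direct sum of two totally isotropic
`f`-invariant subspaces. -/
def HyperbolicMap (Q : QuadraticForm K V) (f : V →ₗ[K] V) : Prop :=
  ∃ U W : Submodule K V, TotIsotropic Q U ∧ TotIsotropic Q W ∧
    Invariant f U ∧ Invariant f W ∧ IsCompl U W

/-- `f` is semisimple: every invariant subspace has an invariant complement. -/
def SemisimpleEnd (f : V →ₗ[K] V) : Prop :=
  ∀ U : Submodule K V, Invariant f U → ∃ W : Submodule K V, Invariant f W ∧ IsCompl U W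

end Defs

section UnipotentAction

variable [Field K] [AddCommGroup V] [Module K V] {A : Type*} [CommRing A] [Module A V]
  {B : LinearMap.BilinForm K V} {g h : A}

theorem bilin_add_inv_pow_smul (hB : ∀ u w, B (g • u) w = B u (h • w)) (hgh : g * h = 1)
    (j : ℕ) (u w : V) : B ((g + h) ^ j • u) w = B u ((g + h) ^ j • w) := by
  have hB' : ∀ u w, B (h • u) w = B u (g • w) := fun u w => by
    have := hB (h • u) (g • w)
    rw [smul_smul, smul_smul, hgh, mul_comm h g, hgh, one_smul, one_smul] at this
    exact this.symm
  induction j generalizing u w with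
  | zero => simp
  | succ j ih =>
    rw [pow_succ, mul_smul, ih, add_smul, map_add, LinearMap.add_apply, hB, hB', mul_comm,
      mul_smul, add_smul, map_add, add_comm]

theorem bilin_smul_add_inv_pow_self [CharP K 2] (hB : ∀ u w, B (g • u) w = B u (h • w))
    (hgh : g * h = 1) (hA : B.IsAlt) (hS : ∀ u w, B u w = B w u) (j : ℕ) (u : V) :
    B u ((g + h) ^ j • u) = 0 := by
  obtain ⟨r, rfl | rfl⟩ := Nat.even_or_odd' j
  · rw [two_mul, pow_add, mul_smul, ← bilin_add_inv_pow_smul hB hgh]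
    exact hA _
  · rw [two_mul, add_assoc, pow_add, pow_succ, mul_smul, mul_smul,
      ← bilin_add_inv_pow_smul hB hgh, smul_comm]
    rw [add_smul, map_add, ← hB, hS (g • _)]
    exact CharTwo.add_self_eq_zero _

theorem bilin_add_smul_mul_self (hB : ∀ u w, B (g • u) w = B u (h • w)) (hgh : g * h = 1)
    (hS : ∀ u w, B u w = B w u) (j : ℕ) (x y : V) :
    B (x + y) (((g + h) ^ j * g) • (x + y)) = B x (((g + h) ^ j * g) • x) +
      B x ((g + h) ^ (j + 1) • y) + B y (((g + h) ^ j * g) • y) := by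
  have e : B y (((g + h) ^ j * g) • x) = B x (((g + h) ^ j * h) • y) := by
    rw [hS, mul_comm, mul_smul, hB, bilin_add_inv_pow_smul hB hgh, smul_smul]
  rw [smul_add, map_add, map_add, LinearMap.add_apply, LinearMap.add_apply, e, pow_succ, mul_add,
    add_smul, map_add]
  ring

theorem add_inv_pow_mul_add_one_sq (h2 : (2 : A) = 0) (hgh : g * h = 1) {p : ℕ}
    (hp : (g + h) ^ (p + 1) = 0) : (g + h) ^ p * (g + 1) * (g + 1) = 0 := by
  linear_combination g * hp + (g + h) ^ p * g * h2 - (g + h) ^ p * hgh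

theorem bilin_add_one_smul_self (h2 : (2 : A) = 0) (hB : ∀ u w, B (g • u) w = B u (h • w))
    (hgh : g * h = 1) (j : ℕ) (u : V) :
    B ((g + 1) • u) (((g + h) ^ j * g) • (g + 1) • u) = B u (((g + h) ^ (j + 1) * g) • u) := by
  have e : ∀ w, B ((g + 1) • u) w = B u ((h + 1) • w) := fun w => by simp [add_smul, hB]
  rw [e, smul_smul, smul_smul]
  congr 2
  linear_combination (g + h) ^ j * g * hgh + (g + h) ^ j * g * h2

theorem bilin_add_add_one_smul (h2 : (2 : A) = 0) (hB : ∀ u w, B (g • u) w = B u (h • w))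
    (hgh : g * h = 1) {p : ℕ} (hp : (g + h) ^ (p + 1) = 0) (x w z : V) :
    B (x + (g + 1) • w) (((g + h) ^ p * (g + 1)) • z) =
      B x (((g + h) ^ p * (g + 1)) • z) := by
  have e : B ((g + 1) • w) (((g + h) ^ p * (g + 1)) • z) =
      B w ((h + 1) • ((g + h) ^ p * (g + 1)) • z) := by simp [add_smul, hB]
  have e0 : (h + 1) * ((g + h) ^ p * (g + 1)) = 0 := by
    linear_combination h * add_inv_pow_mul_add_one_sq h2 hgh hp -
      (g + h) ^ p * (g + 1) * hgh
  rw [map_add, LinearMap.add_apply, e, smul_smul, e0, zero_smul, map_zero, add_zero]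

theorem bilin_add_inv_pow_mul_pow_smul_self [CharP K 2]
    (hB : ∀ u w, B (g • u) w = B u (h • w)) (hgh : g * h = 1) (hA : B.IsAlt)
    (hS : ∀ u w, B u w = B w u) {x : V} (hx : ∀ j, B x (((g + h) ^ j * g) • x) = 0) (k : ℕ) :
    ∀ j, B x (((g + h) ^ j * g ^ k) • x) = 0 := by
  induction k using Nat.twoStepInduction with
  | zero => simpa using fun j => bilin_smul_add_inv_pow_self hB hgh hA hS j x
  | one => simpa using hx
  | more k h1 h2 =>
    intro j
    rw [show (g + h) ^ j * g ^ (k + 2) =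
      (g + h) ^ (j + 1) * g ^ (k + 1) - (g + h) ^ j * g ^ k by
        linear_combination -(g + h) ^ j * g ^ k * hgh, sub_smul, map_sub, h2, h1, sub_zero]

theorem bilin_pow_sub_inv_pow_smul (h2 : (2 : A) = 0) (hgh : g * h = 1) {x z : V}
    (hxz : ∀ j, B x ((g + h) ^ j • z) = 0) (k : ℕ) :
    ∀ j, B x (((g + h) ^ j * (g ^ k - h ^ k)) • z) = 0 := by
  induction k using Nat.twoStepInduction with
  | zero => simp
  | one =>
    intro j
    rw [show (g + h) ^ j * (g ^ 1 - h ^ 1) = (g + h) ^ (j + 1) by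
      linear_combination -(g + h) ^ j * h * h2, hxz]
  | more k h1 h2 =>
    intro j
    rw [show (g + h) ^ j * (g ^ (k + 2) - h ^ (k + 2)) =
      (g + h) ^ (j + 1) * (g ^ (k + 1) - h ^ (k + 1)) - (g + h) ^ j * (g ^ k - h ^ k) by
        linear_combination (g + h) ^ j * (h ^ k - g ^ k) * hgh, sub_smul, map_sub, h2, h1,
      sub_zero]

theorem bilin_pow_smul_pow_smul (hB : ∀ u w, B (g • u) w = B u (h • w)) (hgh : g * h = 1)
    (i : ℕ) (u w : V) : B (g ^ i • u) (g ^ i • w) = B u w := by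
  induction i with
  | zero => simp
  | succ i ih =>
    rw [pow_succ', mul_smul, hB, mul_smul, smul_smul h, mul_comm h, hgh, one_smul, ih]

theorem bilin_pow_smul (hB : ∀ u w, B (g • u) w = B u (h • w))
    (i : ℕ) (u w : V) : B (g ^ i • u) w = B u (h ^ i • w) := by
  induction i generalizing w with
  | zero => simp
  | succ i ih => rw [pow_succ', mul_smul, hB, ih, smul_smul, ← pow_succ]

variable [Algebra K A] [IsScalarTower K A V]

/-- Hensel-type approximation: `x` is corrected by an element of `(g + 1)V` until the cyclic
module it generates is totally isotropic for the polar form. -/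
theorem exists_add_bilin_isotropic (h2 : (2 : A) = 0)
    (hB : ∀ u w, B (g • u) w = B u (h • w)) (hgh : g * h = 1) (hS : ∀ u w, B u w = B w u)
    {p : ℕ} (hp : (g + h) ^ (p + 1) = 0) (hv : ∀ v, B v (((g + h) ^ p * g) • v) = 0)
    {x z : V} (hxz : B x (((g + h) ^ p * (g + 1)) • z) ≠ 0) (d : ℕ) :
    ∃ w : V, ∀ j, p ≤ j + d →
      B (x + (g + 1) • w) (((g + h) ^ j * g) • (x + (g + 1) • w)) = 0 := by
  have h0 : ∀ j, p + 1 ≤ j → (g + h) ^ j = 0 := fun j hj => pow_eq_zero_of_le hj hp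
  have hv' : ∀ v j, p ≤ j → B v (((g + h) ^ j * g) • v) = 0 := fun v j hj => by
    rcases hj.eq_or_lt with rfl | hj
    · exact hv v
    · simp [h0 j hj]
  induction d with
  | zero => exact ⟨0, fun j hj => hv' _ j hj⟩
  | succ d ih =>
    obtain ⟨w, hd⟩ := ih
    by_cases hpd : p ≤ d
    · exact ⟨w, fun j _ => hd j (by omega)⟩
    obtain ⟨l, rfl⟩ : ∃ l, p = l + d + 1 := ⟨p - d - 1, by omega⟩
    rw [← bilin_add_add_one_smul h2 hB hgh hp x w z] at hxz
    set x' := x + (g + 1) • w with hx'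
    set c := B x' (((g + h) ^ (l + d + 1) * (g + 1)) • z) with hc
    set k : K := -B x' (((g + h) ^ l * g) • x') / c with hk
    have key : x + (g + 1) • (w + k • ((g + h) ^ d • z)) =
        x' + k • ((g + 1) • ((g + h) ^ d • z)) := by
      rw [smul_add, ← add_assoc, smul_comm (g + 1) k]
    refine ⟨w + k • ((g + h) ^ d • z), fun j hj => ?_⟩
    rw [key, bilin_add_smul_mul_self hB hgh hS]
    have e1 : B (k • ((g + 1) • ((g + h) ^ d • z)))
        (((g + h) ^ j * g) • (k • ((g + 1) • ((g + h) ^ d • z)))) = 0 := by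
      rw [smul_comm _ k, (B _).map_smul, LinearMap.map_smul₂,
        bilin_add_one_smul_self h2 hB hgh, bilin_add_inv_pow_smul hB hgh, smul_smul, smul_smul, smul_smul]
      have := hv' z (d + (j + 1) + d) (by omega)
      rw [show (g + h) ^ d * ((g + h) ^ (j + 1) * g) * (g + h) ^ d =
        (g + h) ^ (d + (j + 1) + d) * g by ring, this, smul_zero]
    have e2 : B x' ((g + h) ^ (j + 1) • (k • ((g + 1) • ((g + h) ^ d • z)))) =
        k * B x' (((g + h) ^ (j + 1 + d) * (g + 1)) • z) := by
      rw [smul_comm _ k, (B _).map_smul, smul_smul, smul_smul, smul_eq_mul]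
      congr 3
      ring
    rw [e1, e2, add_zero]
    rcases (show l ≤ j by omega).eq_or_lt with rfl | hj'
    · rw [add_right_comm, ← hc, hk, div_mul_cancel₀ _ hxz, add_neg_cancel]
    · rw [h0 (j + 1 + d) (by omega), hd j (by omega)]
      simp

theorem exists_add_isotropic [CharP K 2] (Q : QuadraticForm K V) (h2 : (2 : A) = 0)
    (hQ : ∀ v, Q (g • v) = Q v) (hB : ∀ u w, Q.polarBilin (g • u) w = Q.polarBilin u (h • w))
    (hgh : g * h = 1) {p : ℕ} (hp : (g + h) ^ (p + 1) = 0)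
    (hv : ∀ v, Q.polarBilin v (((g + h) ^ p * g) • v) = 0)
    {x z : V} (hxz : Q.polarBilin x (((g + h) ^ p * (g + 1)) • z) ≠ 0) :
    ∃ w : V, Q (x + (g + 1) • w) = 0 ∧ ∀ j,
      Q.polarBilin (x + (g + 1) • w) (((g + h) ^ j * g) • (x + (g + 1) • w)) = 0 := by
  have hS : ∀ u w, Q.polarBilin u w = Q.polarBilin w u := QuadraticMap.polar_comm Q
  have hv' : ∀ v j, p ≤ j → Q.polarBilin v (((g + h) ^ j * g) • v) = 0 := fun v j hj => by
    rcases hj.eq_or_lt with rfl | hj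
    · exact hv v
    · simp [pow_eq_zero_of_le hj hp]
  obtain ⟨w, hw⟩ := exists_add_bilin_isotropic h2 hB hgh hS hp hv hxz p
  rw [← bilin_add_add_one_smul h2 hB hgh hp x w z] at hxz
  set x' := x + (g + 1) • w with hx'
  set c := Q.polarBilin x' (((g + h) ^ p * (g + 1)) • z) with hc
  set k : K := -Q x' / c with hk
  have key : x + (g + 1) • (w + k • ((g + h) ^ p • z)) =
      x' + k • ((g + 1) • ((g + h) ^ p • z)) := by
    rw [smul_add, ← add_assoc, smul_comm (g + 1) k]
  refine ⟨w + k • ((g + h) ^ p • z), ?_, fun j => ?_⟩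
  · have q0 : Q ((g + 1) • ((g + h) ^ p • z)) = 0 := by
      generalize hy : (g + h) ^ p • z = y
      have e1 : Q.polarBilin (g • y) y = 0 := by
        rw [hS, ← hy, bilin_add_inv_pow_smul hB hgh, smul_smul, smul_smul,
          show (g + h) ^ p * g * (g + h) ^ p = (g + h) ^ (p + p) * g by ring]
        exact hv' z _ (by omega)
      rw [QuadraticMap.polarBilin_apply_apply, QuadraticMap.polar, hQ, sub_sub,
        CharTwo.add_self_eq_zero, sub_zero] at e1
      rwa [add_smul, one_smul]
    have e2 : Q.polarBilin x' (k • ((g + 1) • ((g + h) ^ p • z))) = k * c := by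
      rw [(Q.polarBilin _).map_smul, smul_smul, smul_eq_mul, mul_comm (g + 1)]
    rw [key, QuadraticMap.map_add Q, QuadraticMap.map_smul, q0, smul_zero, add_zero,
      ← QuadraticMap.polarBilin_apply_apply, e2, hk, div_mul_cancel₀ _ hxz, add_neg_cancel]
  · rw [key, bilin_add_smul_mul_self hB hgh hS, hw j (by omega), zero_add]
    rw [smul_comm _ k, (Q.polarBilin _).map_smul, smul_comm (((g + h) ^ j * g)) k,
      (Q.polarBilin _).map_smul, LinearMap.map_smul₂, bilin_add_one_smul_self h2 hB hgh,
      bilin_add_inv_pow_smul hB hgh, smul_smul, smul_smul, smul_smul, smul_smul, smul_smul,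
      show (g + h) ^ (j + 1) * (g + 1) * (g + h) ^ p =
        (g + h) ^ (p + 1) * ((g + h) ^ j * (g + 1)) by ring, hp,
      show (g + h) ^ p * ((g + h) ^ (j + 1) * g) * (g + h) ^ p =
        (g + h) ^ (p + (j + 1) + p) * g by ring, hv' z _ (by omega)]
    simp

theorem exists_smul_bilin_add_inv_pow_eq_zero (h2 : (2 : A) = 0) (hgh : g * h = 1)
    {p : ℕ} (hp : (g + h) ^ (p + 1) = 0)
    {x z : V} (hxz : B x (((g + h) ^ p * (g + 1)) • z) ≠ 0) (d : ℕ) :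
    ∃ a : A, ∀ j, p + 1 ≤ j + d → B x ((g + h) ^ j • (1 + a * (g + 1)) • z) = 0 := by
  have h0 : ∀ j, p + 1 ≤ j → (g + h) ^ j = 0 := fun j hj => pow_eq_zero_of_le hj hp
  induction d with
  | zero => exact ⟨0, fun j hj => by simp [h0 j hj]⟩
  | succ d ih =>
    obtain ⟨a, hd⟩ := ih
    by_cases hpd : p + 1 ≤ d
    · exact ⟨a, fun j _ => hd j (by omega)⟩
    obtain ⟨l, rfl⟩ : ∃ l, p = l + d := ⟨p - d, by omega⟩
    have e : ((g + h) ^ (l + d) * (g + 1)) • z =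
        ((g + h) ^ (l + d) * (g + 1)) • (1 + a * (g + 1)) • z := by
      rw [smul_smul]
      congr 1
      linear_combination -a * add_inv_pow_mul_add_one_sq h2 hgh hp
    rw [e] at hxz
    set c := B x (((g + h) ^ (l + d) * (g + 1)) • (1 + a * (g + 1)) • z) with hc
    set k : K := -B x ((g + h) ^ l • (1 + a * (g + 1)) • z) / c with hk
    refine ⟨a + k • ((g + h) ^ d * (1 + a * (g + 1))), fun j hj => ?_⟩
    have e1 : (1 + (a + k • ((g + h) ^ d * (1 + a * (g + 1)))) * (g + 1)) • z =
        (1 + a * (g + 1)) • z + k • (((g + h) ^ d * (g + 1)) • (1 + a * (g + 1)) • z) := by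
      rw [add_mul, ← add_assoc, add_smul, smul_mul_assoc, smul_assoc, smul_smul, mul_right_comm]
    rw [e1, smul_add, map_add, smul_comm _ k, (B x).map_smul, smul_smul _ (_ * (g + 1)), ← mul_assoc,
      ← pow_add, smul_eq_mul]
    rcases (show l ≤ j by omega).eq_or_lt with rfl | hj'
    · rw [← hc, hk, div_mul_cancel₀ _ hxz, add_neg_cancel]
    · rw [h0 (j + d) (by omega), hd j (by omega)]
      simp

theorem bilin_aeval_smul (hB : ∀ u w, B (g • u) w = B u (h • w)) (P : K[X]) (u w : V) :
    B (aeval g P • u) w = B u (aeval h P • w) := by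
  induction P using Polynomial.induction_on' with
  | add P R hP hR => simp only [map_add, add_smul, LinearMap.add_apply, hP, hR]
  | monomial k c =>
    simp only [aeval_monomial, mul_smul, algebraMap_smul, map_smul, LinearMap.smul_apply,
      bilin_pow_smul hB]

theorem bilin_aeval_smul_aeval_smul_self [CharP K 2]
    (hB : ∀ u w, B (g • u) w = B u (h • w)) (hgh : g * h = 1) (hA : B.IsAlt)
    (hS : ∀ u w, B u w = B w u) {x : V} (hx : ∀ j, B x (((g + h) ^ j * g) • x) = 0)
    (P R : K[X]) : B (aeval g P • x) (aeval g R • x) = 0 := by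
  have h0 : ∀ k, B x (g ^ k • x) = 0 := fun k => by
    simpa using bilin_add_inv_pow_mul_pow_smul_self hB hgh hA hS hx k 0
  have h1 : ∀ i j, i ≤ j → B (g ^ i • x) (g ^ j • x) = 0 := fun i j hij => by
    obtain ⟨k, rfl⟩ := Nat.exists_eq_add_of_le hij
    rw [pow_add, mul_smul, bilin_pow_smul_pow_smul hB hgh, h0]
  have h2 : ∀ i j, B (g ^ i • x) (g ^ j • x) = 0 := fun i j => by
    rcases le_total i j with hij | hij
    · exact h1 i j hij
    · rw [hS, h1 j i hij]
  induction P using Polynomial.induction_on' with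
  | add P P' hP hP' => simp only [map_add, add_smul, LinearMap.add_apply, hP, hP', add_zero]
  | monomial i c =>
    induction R using Polynomial.induction_on' with
    | add R R' hR hR' => rw [map_add, add_smul, map_add, hR, hR', add_zero]
    | monomial j e =>
      simp only [aeval_monomial, mul_smul, algebraMap_smul, map_smul, LinearMap.smul_apply, h2,
        smul_zero]

theorem map_aeval_smul_eq_zero [CharP K 2] (Q : QuadraticForm K V) (hQ : ∀ v, Q (g • v) = Q v)
    (hB : ∀ u w, Q.polarBilin (g • u) w = Q.polarBilin u (h • w)) (hgh : g * h = 1)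
    (hA : Q.polarBilin.IsAlt) (hS : ∀ u w, Q.polarBilin u w = Q.polarBilin w u) {x : V}
    (hx : ∀ j, Q.polarBilin x (((g + h) ^ j * g) • x) = 0) (hx0 : Q x = 0) (P : K[X]) :
    Q (aeval g P • x) = 0 := by
  induction P using Polynomial.induction_on' with
  | add P R hP hR =>
    rw [map_add, add_smul, QuadraticMap.map_add Q, hP, hR, ← QuadraticMap.polarBilin_apply_apply,
      bilin_aeval_smul_aeval_smul_self hB hgh hA hS hx, add_zero, add_zero]
  | monomial k c =>
    have : Q (g ^ k • x) = 0 := by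
      induction k with
      | zero => simpa using hx0
      | succ k ih => rw [pow_succ', mul_smul, hQ, ih]
    rw [aeval_monomial, mul_smul, algebraMap_smul, QuadraticMap.map_smul, this, smul_zero]

theorem bilin_aeval_smul_comm (h2 : (2 : A) = 0) (hB : ∀ u w, B (g • u) w = B u (h • w))
    (hgh : g * h = 1) {x z : V} (hxz : ∀ j, B x ((g + h) ^ j • z) = 0) (P R : K[X]) :
    B (aeval g P • x) (aeval g R • z) = B (aeval g R • x) (aeval g P • z) := by
  have h0 : ∀ k, B x (g ^ k • z) = B (g ^ k • x) z := fun k => by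
    rw [bilin_pow_smul hB, ← sub_eq_zero, ← map_sub, ← sub_smul]
    simpa using bilin_pow_sub_inv_pow_smul h2 hgh hxz k 0
  have h1 : ∀ i j, i ≤ j → B (g ^ i • x) (g ^ j • z) = B (g ^ j • x) (g ^ i • z) :=
    fun i j hij => by
      obtain ⟨k, rfl⟩ := Nat.exists_eq_add_of_le hij
      rw [pow_add, mul_smul, mul_smul, bilin_pow_smul_pow_smul hB hgh,
        bilin_pow_smul_pow_smul hB hgh, h0]
  have h2 : ∀ i j, B (g ^ i • x) (g ^ j • z) = B (g ^ j • x) (g ^ i • z) := fun i j => by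
    rcases le_total i j with hij | hij
    · exact h1 i j hij
    · rw [h1 j i hij]
  induction P using Polynomial.induction_on' with
  | add P P' hP hP' => simp only [map_add, add_smul, LinearMap.add_apply, hP, hP']
  | monomial i c =>
    induction R using Polynomial.induction_on' with
    | add R R' hR hR' => simp only [map_add, add_smul, LinearMap.add_apply, hR, hR']
    | monomial j e =>
      simp only [aeval_monomial, mul_smul, algebraMap_smul, map_smul, LinearMap.smul_apply,
        h2 i j, smul_comm c e]

theorem bilin_aeval_smul_aeval_smul_eq_zero [CharP K 2] (h2 : (2 : A) = 0)
    (hB : ∀ u w, B (g • u) w = B u (h • w))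
    (hgh : g * h = 1) {x z : V} (hxz : ∀ j, B x ((g + h) ^ j • z) = 0) (P : K[X]) :
    B (aeval g P • x) (aeval g P • z) = 0 := by
  induction P using Polynomial.induction_on' with
  | add P R hP hR =>
    rw [map_add, add_smul, add_smul, map_add, map_add, LinearMap.add_apply, LinearMap.add_apply,
      hP, hR, bilin_aeval_smul_comm h2 hB hgh hxz R P, zero_add, add_zero,
      CharTwo.add_self_eq_zero]
  | monomial k c =>
    have : B x z = 0 := by simpa using hxz 0
    simp only [aeval_monomial, mul_smul, algebraMap_smul, map_smul, LinearMap.smul_apply,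
      bilin_pow_smul_pow_smul hB hgh, this, smul_zero]

/-- On a hyperbolic module `Ax ⊕ Az` the map `x ↦ z`, `z ↦ x + z` is an `A`-linear isometry whose
minimal polynomial divides `X ^ 2 + X + 1`. -/
theorem exists_isometry_sq_add_self_add_one [CharP K 2] (Q : QuadraticForm K V)
    (hN : ∀ u, (∀ w, Q.polarBilin u w = 0) → u = 0)
    (hgen : ∀ a : A, ∃ P : K[X], aeval g P = a) (h2 : (2 : A) = 0)
    (hQ : ∀ v, Q (g • v) = Q v) (hB : ∀ u w, Q.polarBilin (g • u) w = Q.polarBilin u (h • w))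
    (hgh : g * h = 1) {x z : V} (hspan : ∀ v, ∃ a b : A, a • x + b • z = v)
    (hx : ∀ j, Q.polarBilin x (((g + h) ^ j * g) • x) = 0) (hx0 : Q x = 0)
    (hz : ∀ j, Q.polarBilin z (((g + h) ^ j * g) • z) = 0) (hz0 : Q z = 0)
    (hxz : ∀ j, Q.polarBilin x ((g + h) ^ j • z) = 0) :
    ∃ s : V ≃ₗ[K] V, (∀ v, Q (s v) = Q v) ∧ (∀ v, s (s v) + s v + v = 0) ∧
      (∀ (a : A) v, s (a • v) = a • s v) ∧ s x = z := by
  have hS : ∀ u w, Q.polarBilin u w = Q.polarBilin w u := QuadraticMap.polar_comm Q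
  have hA : Q.polarBilin.IsAlt := fun v => by
    rw [QuadraticMap.polarBilin_apply_apply, QuadraticMap.polar_self, two_nsmul,
      CharTwo.add_self_eq_zero]
  have hQx : ∀ a : A, Q (a • x) = 0 := fun a => by
    obtain ⟨P, rfl⟩ := hgen a
    exact map_aeval_smul_eq_zero Q hQ hB hgh hA hS hx hx0 P
  have hQz : ∀ a : A, Q (a • z) = 0 := fun a => by
    obtain ⟨P, rfl⟩ := hgen a
    exact map_aeval_smul_eq_zero Q hQ hB hgh hA hS hz hz0 P
  have hcomm : ∀ a b : A, Q.polarBilin (a • x) (b • z) = Q.polarBilin (b • x) (a • z) :=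
    fun a b => by
      obtain ⟨P, rfl⟩ := hgen a
      obtain ⟨R, rfl⟩ := hgen b
      exact bilin_aeval_smul_comm h2 hB hgh hxz P R
  have hself : ∀ a : A, Q.polarBilin (a • x) (a • z) = 0 := fun a => by
    obtain ⟨P, rfl⟩ := hgen a
    exact bilin_aeval_smul_aeval_smul_eq_zero h2 hB hgh hxz P
  have hQv : ∀ a b : A, Q (a • x + b • z) = Q.polarBilin (a • x) (b • z) := fun a b => by
    rw [QuadraticMap.map_add Q, hQx, hQz, zero_add, zero_add, QuadraticMap.polarBilin_apply_apply]
  have hQs : ∀ a b : A, Q (b • x + (a + b) • z) = Q (a • x + b • z) := fun a b => by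
    rw [hQv, hQv, add_smul, map_add, hself, add_zero, hcomm]
  let π : A × A →ₗ[K] V :=
    { toFun := fun c => c.1 • x + c.2 • z
      map_add' := fun c d => by simp only [Prod.fst_add, Prod.snd_add, add_smul]; abel
      map_smul' := fun k c => by simp [smul_add] }
  let τ : A × A →ₗ[K] A × A :=
    (LinearMap.snd K A A).prod (LinearMap.fst K A A + LinearMap.snd K A A)
  have hπ : Function.Surjective π := fun v => by
    obtain ⟨a, b, hab⟩ := hspan v
    exact ⟨(a, b), hab⟩
  have hπτ : ∀ c, Q (π (τ c)) = Q (π c) := fun c => hQs c.1 c.2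
  have hτ : ∀ c, τ (τ c) + τ c + c = 0 := fun c => by
    ext
    · change c.1 + c.2 + c.2 + c.1 = 0
      linear_combination (c.1 + c.2) * h2
    · change c.2 + (c.1 + c.2) + (c.1 + c.2) + c.2 = 0
      linear_combination (c.1 + 2 * c.2) * h2
  have hτs : ∀ c, ∃ d, τ d = c := fun c => ⟨-τ c - c, by
    rw [map_sub, map_neg, ← sub_eq_zero, ← neg_eq_zero, ← hτ c]
    abel⟩
  have hker : ∀ c, π c = 0 → π (τ c) = 0 := fun c hc => hN _ fun w => by
    obtain ⟨d, rfl⟩ := hπ w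
    obtain ⟨e, rfl⟩ := hτs d
    rw [QuadraticMap.polarBilin_apply_apply, QuadraticMap.polar, ← map_add, ← map_add, hπτ, hπτ,
      hπτ, map_add, hc]
    simp
  obtain ⟨ρ, hρ⟩ := π.exists_rightInverse_of_surjective (LinearMap.range_eq_top.2 hπ)
  have hρ' : ∀ v, π (ρ v) = v := fun v => LinearMap.congr_fun hρ v
  let s : V →ₗ[K] V := π ∘ₗ τ ∘ₗ ρ
  have hs : ∀ c, s (π c) = π (τ c) := fun c => by
    change π (τ (ρ (π c))) = _
    rw [← sub_eq_zero, ← map_sub, ← map_sub]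
    exact hker _ (by rw [map_sub, hρ', sub_self])
  have hs3 : ∀ v, s (s v) + s v + v = 0 := fun v => by
    obtain ⟨c, rfl⟩ := hπ v
    rw [hs, hs, ← map_add, ← map_add, hτ, map_zero]
  have hs1 : ∀ v, s (-s v - v) = v := fun v => by
    rw [map_sub, map_neg, ← sub_eq_zero, ← neg_eq_zero, ← hs3 v]
    abel
  have hs2 : ∀ v, -s (s v) - s v = v := fun v => by
    rw [← sub_eq_zero, ← neg_eq_zero, ← hs3 v]
    abel
  refine ⟨LinearEquiv.ofLinearMap s (-s - LinearMap.id) (LinearMap.ext hs1) (LinearMap.ext hs2),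
    fun v => ?_, hs3, fun a v => ?_, ?_⟩
  · obtain ⟨c, rfl⟩ := hπ v
    change Q (s _) = _
    rw [hs, hπτ]
  · obtain ⟨c, rfl⟩ := hπ v
    change s _ = a • s _
    have : a • π c = π (a • c) := by
      change a • (c.1 • x + c.2 • z) = (a * c.1) • x + (a * c.2) • z
      rw [smul_add, smul_smul, smul_smul]
    rw [this, hs, hs]
    change (a * c.2) • x + (a * c.1 + a * c.2) • z = a • (c.2 • x + (c.1 + c.2) • z)
    rw [smul_add, smul_smul, smul_smul, mul_add]
  · change s x = z
    have : x = π (1, 0) := by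
      change x = (1 : A) • x + (0 : A) • z
      simp
    rw [this, hs]
    change (0 : A) • x + (1 + 0 : A) • z = z
    simp

theorem exists_smul_add_smul_eq_of_isNilpotent {ν : A} (hν : IsNilpotent ν) {x z : V}
    (hspan : ∀ v, ∃ a b : A, a • x + b • z = v) (w y : V) (v : V) :
    ∃ a b : A, a • (x + ν • w) + b • (z + ν • y) = v := by
  have H : ∀ (k : ℕ) (v : V), ∃ (a b : A) (u : V),
      a • (x + ν • w) + b • (z + ν • y) + ν ^ k • u = v := fun k => by
    induction k with
    | zero => exact fun v => ⟨0, 0, v, by simp⟩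
    | succ k ih =>
      intro v
      obtain ⟨a, b, u, rfl⟩ := ih v
      obtain ⟨c, d, rfl⟩ := hspan u
      refine ⟨a + ν ^ k * c, b + ν ^ k * d, -(c • w + d • y), ?_⟩
      module
  obtain ⟨m, hm⟩ := hν
  obtain ⟨a, b, u, h⟩ := H m v
  exact ⟨a, b, by simpa [hm] using h⟩

theorem bilin_socle_smul_ne_zero (hB : ∀ u w, B (g • u) w = B u (h • w))
    (hgen : ∀ a : A, ∃ P : K[X], aeval g P = a) (hN : ∀ u, (∀ w, B w u = 0) → u = 0)
    {e : A} (he : ∀ a, ∃ α : K, e * a = α • e)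
    (he0 : ∃ w : V, e • w ≠ 0) {x z : V} (hspan : ∀ v, ∃ a b : A, a • x + b • z = v)
    (hv : ∀ v, B v (e • v) = 0) : B x (e • z) ≠ 0 := by
  intro hxz
  have hzx : B z (e • x) = 0 := by
    have := hv (x + z)
    rw [smul_add, map_add, map_add, LinearMap.add_apply, LinearMap.add_apply, hv, hv, hxz] at this
    simpa using this
  have key : ∀ y, B y (e • x) = 0 → B y (e • z) = 0 → ∀ w, B y (e • w) = 0 :=
    fun y h1 h2 w => by
      obtain ⟨a, b, rfl⟩ := hspan w
      obtain ⟨α, hα⟩ := he a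
      obtain ⟨β, hβ⟩ := he b
      simp only [smul_add, smul_smul, hα, hβ, map_add, smul_assoc, map_smul, h1, h2, smul_zero,
        add_zero]
  have hx := key x (hv x) hxz
  have hz := key z hzx (hv z)
  obtain ⟨w, hw⟩ := he0
  refine hw (hN _ fun y => ?_)
  obtain ⟨a, b, rfl⟩ := hspan y
  obtain ⟨P, rfl⟩ := hgen a
  obtain ⟨R, rfl⟩ := hgen b
  rw [map_add, LinearMap.add_apply, bilin_aeval_smul hB, bilin_aeval_smul hB, smul_comm _ e,
    smul_comm _ e, hx, hz, add_zero]

theorem smul_eq_zero_of_bilin_smul_eq_zero (hB : ∀ u w, B (g • u) w = B u (h • w))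
    (hgen : ∀ a : A, ∃ P : K[X], aeval g P = a) (hS : ∀ u w, B u w = B w u)
    {e : A} (he : ∀ a, a ≠ 0 → ∃ c, c * a = e) {v : V} (hv : B v (e • v) ≠ 0) (a : A)
    (ha : ∀ b : A, B (a • v) (b • v) = 0) : a • v = 0 := by
  by_cases ha0 : a = 0
  · rw [ha0, zero_smul]
  obtain ⟨c, rfl⟩ := he a ha0
  obtain ⟨P, rfl⟩ := hgen c
  rw [mul_smul, hS, bilin_aeval_smul hB, ha] at hv
  exact absurd rfl hv

theorem exists_isometry_of_bilin_socle_smul_self [CharP K 2] (Q : QuadraticForm K V)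
    (hN : ∀ u, (∀ w, Q.polarBilin u w = 0) → u = 0)
    (hgen : ∀ a : A, ∃ P : K[X], aeval g P = a) (h2 : (2 : A) = 0)
    (hQ : ∀ v, Q (g • v) = Q v) (hB : ∀ u w, Q.polarBilin (g • u) w = Q.polarBilin u (h • w))
    (hgh : g * h = 1) {p : ℕ} (hp : (g + h) ^ (p + 1) = 0) (hν : IsNilpotent (g + 1))
    (he : ∀ a, ∃ α : K, (g + h) ^ p * (g + 1) * a = α • ((g + h) ^ p * (g + 1)))
    (he0 : ∃ w : V, ((g + h) ^ p * (g + 1)) • w ≠ 0)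
    {x z : V} (hspan : ∀ v, ∃ a b : A, a • x + b • z = v)
    (hv : ∀ v, Q.polarBilin v (((g + h) ^ p * (g + 1)) • v) = 0) :
    ∃ (s : V ≃ₗ[K] V) (y : V), (∀ v, Q (s v) = Q v) ∧ (∀ v, s (s v) + s v + v = 0) ∧
      (∀ (a : A) v, s (a • v) = a • s v) ∧ ∀ v, ∃ a b : A, a • y + b • s y = v := by
  have hS : ∀ u w, Q.polarBilin u w = Q.polarBilin w u := QuadraticMap.polar_comm Q
  have hA : Q.polarBilin.IsAlt := fun v => by
    rw [QuadraticMap.polarBilin_apply_apply, QuadraticMap.polar_self, two_nsmul,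
      CharTwo.add_self_eq_zero]
  have hv' : ∀ v, Q.polarBilin v (((g + h) ^ p * g) • v) = 0 := fun v => by
    have := hv v
    rwa [mul_add, mul_one, add_smul, map_add, bilin_smul_add_inv_pow_self hB hgh hA hS,
      add_zero] at this
  have hN' : ∀ u, (∀ w, Q.polarBilin w u = 0) → u = 0 := fun u hu =>
    hN u fun w => by rw [hS, hu]
  obtain ⟨w, hw0, hw⟩ := exists_add_isotropic Q h2 hQ hB hgh hp hv'
    (bilin_socle_smul_ne_zero hB hgen hN' he he0 hspan hv)
  have hspan1 := exists_smul_add_smul_eq_of_isNilpotent hν hspan w 0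
  rw [smul_zero, add_zero] at hspan1
  set x₁ := x + (g + 1) • w
  have hspan1' : ∀ v, ∃ a b : A, a • z + b • x₁ = v := fun v => by
    obtain ⟨a, b, h⟩ := hspan1 v
    exact ⟨b, a, by rw [add_comm, h]⟩
  obtain ⟨y, hy0, hy⟩ := exists_add_isotropic Q h2 hQ hB hgh hp hv'
    (bilin_socle_smul_ne_zero hB hgen hN' he he0 hspan1' hv)
  have hspan2 := exists_smul_add_smul_eq_of_isNilpotent hν hspan1 0 y
  rw [smul_zero, add_zero] at hspan2
  set z₁ := z + (g + 1) • y
  obtain ⟨a, ha⟩ := exists_smul_bilin_add_inv_pow_eq_zero h2 hgh hp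
    (bilin_socle_smul_ne_zero hB hgen hN' he he0 hspan2 hv) (p + 1)
  have ez : (1 + a * (g + 1)) • z₁ = z₁ + (g + 1) • (a • z₁) := by module
  have hspan3 := exists_smul_add_smul_eq_of_isNilpotent hν hspan2 0 (a • z₁)
  rw [smul_zero, add_zero, ← ez] at hspan3
  obtain ⟨P, hP⟩ := hgen (1 + a * (g + 1))
  have hz0 : Q ((1 + a * (g + 1)) • z₁) = 0 := by
    rw [← hP]
    exact map_aeval_smul_eq_zero Q hQ hB hgh hA hS hy hy0 P
  have hz : ∀ j, Q.polarBilin ((1 + a * (g + 1)) • z₁)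
      (((g + h) ^ j * g) • (1 + a * (g + 1)) • z₁) = 0 := fun j => by
    obtain ⟨R, hR⟩ := hgen (((g + h) ^ j * g) * (1 + a * (g + 1)))
    rw [smul_smul, ← hP, hP, ← hR, ← hP]
    exact bilin_aeval_smul_aeval_smul_self hB hgh hA hS hy P R
  obtain ⟨s, hs1, hs2, hs3, hs4⟩ := exists_isometry_sq_add_self_add_one Q hN hgen h2 hQ hB hgh
    hspan3 hw hw0 hz hz0 fun j => ha j (by omega)
  exact ⟨s, x₁, hs1, hs2, hs3, by rwa [hs4]⟩

end UnipotentAction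

section AdjoinRoot

variable [Field K] {m : ℕ}

theorem adjoinRoot_exists_mul_eq (a : AdjoinRoot ((X - 1 : K[X]) ^ (m + 1))) (ha : a ≠ 0) :
    ∃ c, c * a = (AdjoinRoot.root _ - 1) ^ m := by
  have hroot : ∀ k, (AdjoinRoot.root ((X - 1 : K[X]) ^ (m + 1)) - 1) ^ k =
      AdjoinRoot.mk _ ((X - 1) ^ k) := fun k => by simp
  obtain ⟨P, rfl⟩ := AdjoinRoot.mk_surjective a
  have hP : P ≠ 0 := by
    rintro rfl
    exact ha (map_zero _)
  obtain ⟨R, hR, hR1⟩ := Polynomial.exists_eq_pow_rootMultiplicity_mul_and_not_dvd P hP 1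
  set r := P.rootMultiplicity 1
  rw [C_1] at hR hR1
  have hr : r ≤ m := by
    by_contra hr
    refine ha (AdjoinRoot.mk_eq_zero.2 ?_)
    rw [hR]
    exact (pow_dvd_pow _ (by omega)).mul_right _
  have hirr : Irreducible (X - 1 : K[X]) := by simpa using irreducible_X_sub_C (1 : K)
  obtain ⟨u, w, huw⟩ := ((hirr.coprime_iff_not_dvd).2 hR1).pow_left (m := m + 1)
  refine ⟨AdjoinRoot.mk _ ((X - 1) ^ (m - r) * w), ?_⟩
  rw [hroot, ← map_mul, AdjoinRoot.mk_eq_mk]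
  refine ⟨-(X - 1) ^ m * u, ?_⟩
  have : (X - 1 : K[X]) ^ m = (X - 1) ^ (m - r) * (X - 1) ^ r := by
    rw [← pow_add, Nat.sub_add_cancel hr]
  rw [hR]
  linear_combination (X - 1) ^ m * huw - w * R * this

theorem adjoinRoot_pow_mul_eq (a : AdjoinRoot ((X - 1 : K[X]) ^ (m + 1))) :
    ∃ α : K, (AdjoinRoot.root _ - 1) ^ m * a = α • (AdjoinRoot.root _ - 1) ^ m := by
  obtain ⟨P, rfl⟩ := AdjoinRoot.mk_surjective a
  refine ⟨P.eval 1, ?_⟩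
  obtain ⟨R, hR⟩ := X_sub_C_dvd_sub_C_eval (p := P) (a := 1)
  have hroot : (AdjoinRoot.root ((X - 1 : K[X]) ^ (m + 1)) - 1) ^ m =
      AdjoinRoot.mk _ ((X - 1) ^ m) := by simp
  rw [hroot, Algebra.smul_def, AdjoinRoot.algebraMap_eq, ← AdjoinRoot.mk_C, ← map_mul, ← map_mul,
    AdjoinRoot.mk_eq_mk]
  refine ⟨R, ?_⟩
  rw [C_1] at hR
  linear_combination (X - 1) ^ m * hR

theorem adjoinRoot_root_pow [CharP K 2] {k : ℕ} (hk : m ≤ 2 ^ k) :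
    AdjoinRoot.root ((X - 1 : K[X]) ^ m) ^ 2 ^ k = 1 := by
  rw [← sub_eq_zero]
  have : AdjoinRoot.root ((X - 1 : K[X]) ^ m) ^ 2 ^ k - 1 =
      AdjoinRoot.mk _ ((X - 1) ^ 2 ^ k) := by
    rw [sub_pow_char_pow]
    simp
  rw [this, AdjoinRoot.mk_eq_zero]
  exact pow_dvd_pow _ hk

end AdjoinRoot

section Cyclic

variable [Field K] [AddCommGroup V] [Module K V]

theorem exists_aeval_eq_of_mem_cyclicSpan {f : V →ₗ[K] V} {x v : V} (hv : v ∈ cyclicSpan f x) :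
    ∃ P : K[X], aeval f P x = v := by
  induction hv using Submodule.span_induction with
  | mem v hv =>
    obtain ⟨k, rfl⟩ := hv
    exact ⟨X ^ k, by simp⟩
  | zero => exact ⟨0, by simp⟩
  | add u w _ _ hu hw =>
    obtain ⟨P, rfl⟩ := hu
    obtain ⟨R, rfl⟩ := hw
    exact ⟨P + R, by simp⟩
  | smul c u _ hu =>
    obtain ⟨P, rfl⟩ := hu
    exact ⟨c • P, by simp⟩

theorem aeval_mem_cyclicSpan {f : V →ₗ[K] V} (x : V) (P : K[X]) :
    aeval f P x ∈ cyclicSpan f x := by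
  induction P using Polynomial.induction_on' with
  | add P R hP hR =>
    rw [map_add, LinearMap.add_apply]
    exact add_mem hP hR
  | monomial k c =>
    rw [aeval_monomial, Module.End.mul_apply, Module.algebraMap_end_apply]
    exact Submodule.smul_mem _ _ (Submodule.subset_span ⟨k, rfl⟩)

theorem semisimpleEnd_one : SemisimpleEnd (1 : V ≃ₗ[K] V).toLinearMap := fun U _ => by
  obtain ⟨W, hW⟩ := U.exists_isCompl
  exact ⟨W, fun w hw => hw, hW⟩

theorem semisimpleEnd_of_sq_add_self_add_one [FiniteDimensional K V] [CharP K 2]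
    {s : V →ₗ[K] V} (hs : ∀ v, s (s v) + s v + v = 0) : SemisimpleEnd s := by
  have hsq : Squarefree (X ^ 2 + X + 1 : K[X]) := by
    refine Separable.squarefree ⟨0, 1, ?_⟩
    simp
    exact CharTwo.add_self_eq_zero _
  have hss : Module.End.IsSemisimple s :=
    Module.End.isSemisimple_of_squarefree_aeval_eq_zero hsq <| LinearMap.ext fun v => by
      simpa [pow_two] using hs v
  exact fun U hU => Module.End.isSemisimple_iff.1 hss U hU

/-- If `φ` has order dividing `4 ^ k` and `s` commutes with `φ` and has order dividing `3`, then
`φ` and `s` are both powers of `φ * s`. -/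
theorem cyclicSpan_mul_eq_top {φ s : V →ₗ[K] V} (hc : Commute φ s) {k : ℕ}
    (hφ : φ ^ 4 ^ k = 1) (hs : s ^ 3 = 1) {x : V}
    (hspan : ∀ v, ∃ P R : K[X], aeval φ P x + aeval φ R (s x) = v) :
    cyclicSpan (φ * s) x = ⊤ := by
  have hs' : s ^ 4 ^ k = s := by
    obtain ⟨l, hl⟩ : ∃ l, 4 ^ k = 3 * l + 1 := by
      have : 4 ^ k % 3 = 1 := by simp [Nat.pow_mod]
      exact ⟨4 ^ k / 3, by omega⟩
    rw [hl, pow_succ, pow_mul, hs, one_pow, one_mul]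
  have h1 : (φ * s) ^ 4 ^ k = s := by rw [hc.mul_pow, hφ, hs', one_mul]
  have h2 : (φ * s) ^ (1 + 2 * 4 ^ k) = φ := by
    rw [pow_add, mul_comm 2, pow_mul, h1, pow_one, mul_assoc, ← pow_succ', hs, mul_one]
  have key : ∀ P : K[X], aeval φ P = aeval (φ * s) (expand K (1 + 2 * 4 ^ k) P) := fun P => by
    rw [expand_aeval, h2]
  refine eq_top_iff.2 fun v _ => ?_
  obtain ⟨P, R, rfl⟩ := hspan v
  have h3 : aeval φ R (s x) =
      aeval (φ * s) (expand K (1 + 2 * 4 ^ k) R * X ^ 4 ^ k) x := by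
    rw [map_mul, Module.End.mul_apply, ← key, map_pow, aeval_X, h1]
  rw [key P, h3]
  exact add_mem (aeval_mem_cyclicSpan _ _) (aeval_mem_cyclicSpan _ _)

end Cyclic

theorem stmt8 [Field K] [AddCommGroup V] [Module K V] [FiniteDimensional K V]
    (Q : QuadraticForm K V) (hQ : Nondefective Q)
    (hchar : ringChar K = 2) (φ : V ≃ₗ[K] V) (hO : InO Q φ)
    (h1e : IsType1e Q φ.toLinearMap) :
    ∃ η s : V ≃ₗ[K] V, InO Q η ∧ InO Q s ∧ IsCyclicEnd η.toLinearMap ∧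
      SemisimpleEnd s.toLinearMap ∧ s * φ = φ * s ∧ η = φ * s := by
  have : CharP K 2 := ringChar.of_eq hchar
  obtain ⟨m, ⟨hind, hm1, hmin, x, z, hxz⟩, hm⟩ := h1e
  obtain ⟨p, rfl⟩ : ∃ p, m = 2 * p + 1 + 1 := by
    obtain ⟨r, rfl⟩ := hm
    exact ⟨r - 1, by omega⟩
  set F : K[X] := (X - 1) ^ (2 * p + 1 + 1) with hF
  let ρ : AdjoinRoot F →ₐ[K] Module.End K V :=
    Ideal.Quotient.liftₐ (Ideal.span {F}) (aeval φ.toLinearMap) fun P hP => by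
      obtain ⟨R, rfl⟩ := Ideal.mem_span_singleton.1 hP
      rw [map_mul, ← hmin, minpoly.aeval, zero_mul]
  have hρmk : ∀ P : K[X], ρ (AdjoinRoot.mk F P) = aeval φ.toLinearMap P := fun _ => rfl
  let _ : Module (AdjoinRoot F) V := Module.compHom V ρ.toRingHom
  have hρ : ∀ (a : AdjoinRoot F) (v : V), a • v = ρ a v := fun _ _ => rfl
  have _ : IsScalarTower K (AdjoinRoot F) V := ⟨fun k a v => by rw [hρ, hρ, map_smul]; rfl⟩
  set g : AdjoinRoot F := AdjoinRoot.root F with hg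
  have hgφ : ∀ v, g • v = φ v := fun v => by
    rw [hρ, hg, ← AdjoinRoot.mk_X, hρmk, aeval_X]
    rfl
  have haeval : ∀ (P : K[X]) (v : V), aeval g P • v = aeval φ.toLinearMap P v := fun P v => by
    rw [hg, AdjoinRoot.aeval_eq, hρ, hρmk]
  have hgen : ∀ a : AdjoinRoot F, ∃ P : K[X], aeval g P = a := fun a => by
    obtain ⟨P, rfl⟩ := AdjoinRoot.mk_surjective a
    exact ⟨P, AdjoinRoot.aeval_eq P⟩
  have h2 : (2 : AdjoinRoot F) = 0 := by
    rw [← map_ofNat (algebraMap K (AdjoinRoot F)) 2, CharTwo.two_eq_zero, map_zero]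
  set N := 2 * p + 1 + 1 with hN
  have hg4 : g ^ 4 ^ N = 1 := by
    rw [show 4 ^ N = 2 ^ (2 * N) by rw [pow_mul]; norm_num]
    exact adjoinRoot_root_pow (le_trans (by omega) Nat.lt_two_pow_self.le)
  obtain ⟨h, hgh⟩ : ∃ h, g * h = 1 :=
    ⟨g ^ (4 ^ N - 1), by rw [← pow_succ', Nat.sub_add_cancel (Nat.one_le_pow _ _ (by norm_num)), hg4]⟩
  have hQg : ∀ v, Q (g • v) = Q v := fun v => by rw [hgφ, hO]
  have hB : ∀ u w, Q.polarBilin (g • u) w = Q.polarBilin u (h • w) := fun u w => by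
    have hw : w = g • h • w := by rw [smul_smul, hgh, one_smul]
    conv_lhs => rw [hw]
    rw [QuadraticMap.polarBilin_apply_apply, QuadraticMap.polarBilin_apply_apply,
      QuadraticMap.polar, QuadraticMap.polar, ← smul_add, hQg, hQg, hQg]
  have hS : ∀ u w, Q.polarBilin u w = Q.polarBilin w u := QuadraticMap.polar_comm Q
  have hν : g + 1 = g - 1 := by linear_combination h2
  have hνm : (g + 1) ^ N = 0 := by
    have : (g - 1) ^ N = AdjoinRoot.mk F F := by simp [hF, hg]
    rw [hν, this, AdjoinRoot.mk_self]
  have ht : g + h = h * (g + 1) ^ 2 := by linear_combination -g * hgh - g * h * h2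
  have hp : (g + h) ^ (p + 1) = 0 := by
    rw [ht, mul_pow, ← pow_mul, show 2 * (p + 1) = N by omega, hνm, mul_zero]
  have he : (g + h) ^ p * (g + 1) = h ^ p * (g - 1) ^ (2 * p + 1) := by
    rw [ht, ← hν, mul_pow, ← pow_mul, pow_succ, mul_assoc]
  by_cases hv : ∀ v, Q.polarBilin v (((g + h) ^ p * (g + 1)) • v) = 0
  · have he' : ∀ a, ∃ α : K, (g + h) ^ p * (g + 1) * a = α • ((g + h) ^ p * (g + 1)) :=
      fun a => by
        obtain ⟨α, hα⟩ := adjoinRoot_pow_mul_eq a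
        exact ⟨α, by rw [he, mul_assoc, hα, mul_smul_comm]⟩
    have he0 : ∃ w : V, ((g + h) ^ p * (g + 1)) • w ≠ 0 := by
      by_contra! hcon
      have h0 : aeval φ.toLinearMap ((X - 1 : K[X]) ^ (2 * p + 1)) = 0 :=
        LinearMap.ext fun w => by
          have : (g - 1) ^ (2 * p + 1) = g ^ p * ((g + h) ^ p * (g + 1)) := by
            rw [he, ← mul_assoc, ← mul_pow, hgh, one_pow, one_mul]
          rw [← haeval, map_pow, map_sub, aeval_X, map_one, this, mul_smul, hcon, smul_zero,
            LinearMap.zero_apply]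
      have hdvd := minpoly.dvd K _ h0
      rw [hmin, hF] at hdvd
      have hX : (X - 1 : K[X]) ≠ 0 := by simpa using X_sub_C_ne_zero (1 : K)
      have hXu : ¬ IsUnit (X - 1 : K[X]) := by simpa using not_isUnit_X_sub_C (1 : K)
      exact absurd ((pow_dvd_pow_iff hX hXu).1 hdvd) (by omega)
    have hspan : ∀ v, ∃ a b : AdjoinRoot F, a • x + b • z = v := fun v => by
      have hv : v ∈ cyclicSpan φ.toLinearMap x ⊔ cyclicSpan φ.toLinearMap z := by
        rw [hxz.sup_eq_top]
        trivial
      obtain ⟨u, hu, w, hw, rfl⟩ := Submodule.mem_sup.1 hv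
      obtain ⟨P, rfl⟩ := exists_aeval_eq_of_mem_cyclicSpan hu
      obtain ⟨R, rfl⟩ := exists_aeval_eq_of_mem_cyclicSpan hw
      exact ⟨aeval g P, aeval g R, by rw [haeval, haeval]⟩
    obtain ⟨s, y, hs1, hs2, hs3, hy⟩ := exists_isometry_of_bilin_socle_smul_self Q hQ hgen h2 hQg
      hB hgh hp ⟨N, hνm⟩ he' he0 hspan hv
    have hcomm : s * φ = φ * s := LinearEquiv.ext fun v => by
      rw [LinearEquiv.mul_apply, LinearEquiv.mul_apply, ← hgφ, hs3, hgφ]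
    refine ⟨φ * s, s, fun v => ?_, hs1, ⟨y, ?_⟩, semisimpleEnd_of_sq_add_self_add_one hs2, hcomm,
      rfl⟩
    · rw [LinearEquiv.mul_apply, hO, hs1]
    · refine cyclicSpan_mul_eq_top (φ := φ.toLinearMap) (s := s.toLinearMap) (k := N)
        (LinearMap.ext fun v => (LinearEquiv.congr_fun hcomm v).symm)
        (LinearMap.ext fun v => ?_) (LinearMap.ext fun v => ?_) fun v => ?_
      · have := haeval (X ^ 4 ^ N) v
        rw [map_pow, map_pow, aeval_X, aeval_X, hg4, one_smul] at this
        exact this.symm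
      · change s (s (s v)) = v
        rw [← sub_eq_zero, show s (s (s v)) - v = (s (s (s v)) + s (s v) + s v) -
          (s (s v) + s v + v) by abel, hs2, hs2, sub_zero]
      · obtain ⟨a, b, rfl⟩ := hy v
        obtain ⟨P, rfl⟩ := hgen a
        obtain ⟨R, rfl⟩ := hgen b
        exact ⟨P, R, by rw [haeval, haeval]; rfl⟩
  · push Not at hv
    obtain ⟨v, hv⟩ := hv
    refine ⟨φ, 1, hO, fun _ => rfl, ⟨v, ?_⟩, semisimpleEnd_one, by simp, by simp⟩
    have hmem : ∀ a : AdjoinRoot F, a • v ∈ cyclicSpan φ.toLinearMap v := fun a => by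
      obtain ⟨P, rfl⟩ := hgen a
      rw [haeval]
      exact aeval_mem_cyclicSpan v P
    have hsoc : ∀ a : AdjoinRoot F, a ≠ 0 → ∃ c, c * a = (g + h) ^ p * (g + 1) := fun a ha => by
      obtain ⟨c, hc⟩ := adjoinRoot_exists_mul_eq a ha
      exact ⟨h ^ p * c, by rw [mul_assoc, hc, he]⟩
    have hv0 : v ≠ 0 := by
      rintro rfl
      simp at hv
    have hinv : ∀ u ∈ cyclicSpan φ.toLinearMap v, ∃ a : AdjoinRoot F, a • v = u := fun u hu => by
      obtain ⟨P, rfl⟩ := exists_aeval_eq_of_mem_cyclicSpan hu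
      exact ⟨aeval g P, haeval P v⟩
    by_contra htop
    refine hind ⟨cyclicSpan φ.toLinearMap v, fun u hu => ?_, ?_, Submodule.finrank_lt htop,
      fun u hu hu0 => ?_⟩
    · obtain ⟨a, rfl⟩ := hinv u hu
      have := hmem (g * a)
      rwa [mul_smul, hgφ] at this
    · have : cyclicSpan φ.toLinearMap v ≠ ⊥ := fun hbot => hv0 <| by
        have := hmem 1
        rwa [hbot, one_smul, Submodule.mem_bot] at this
      exact Submodule.one_le_finrank_iff.2 this
    · obtain ⟨a, rfl⟩ := hinv u hu
      exact smul_eq_zero_of_bilin_smul_eq_zero hB hgen hS hsoc hv a fun b => hu0 _ (hmem b)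
end

section
/- Suppose char K = 2 and φ ∈ O(V,Q) is of type 1o. Then there exist vectors x, z ∈ V such that: (1) V is the direct sum of the subspace spanned by the vectors φ^k(x), k ≥ 0, and the subspace spanned by the vectors φ^k(z), k ≥ 0; (2) f_Q(x, φ^k(x)) = f_Q(z, φ^k(z)) for all k ≥ 0; (3) f_Q(φ^k(x), z) = f_Q(x, φ^{k−1}(z)) for all k ≥ 1; and (4) Q(x) = Q(z). -/
open Polynomial Module

variable {K V : Type*}

set_option linter.unusedSectionVars false

section SelfDual

variable {B : Type*} [Field K] [AddCommGroup V] [Module K V] [CommRing B] [Algebra K B]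
  [Module B V] [IsScalarTower K B V] {Q : QuadraticForm K V} {t t' : B}

theorem two_eq_zero_of_algebra (B : Type*) [CommRing B] [Algebra K B] [CharP K 2] :
    (2 : B) = 0 := by
  rw [← map_ofNat (algebraMap K B) 2, CharTwo.two_eq_zero, map_zero]

theorem polarBilin_self [CharP K 2] (u : V) : Q.polarBilin u u = 0 := by
  simp [QuadraticMap.polar_self, CharTwo.two_eq_zero]

theorem polarBilin_symm (u w : V) : Q.polarBilin u w = Q.polarBilin w u := by
  simp [QuadraticMap.polar_comm]

theorem map_add_polarBilin (u w : V) : Q (u + w) = Q u + Q w + Q.polarBilin u w := by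
  simp [QuadraticMap.polar]

theorem polarBilin_smul_smul (hQ : ∀ v, Q (t • v) = Q v) (u w : V) :
    Q.polarBilin (t • u) (t • w) = Q.polarBilin u w := by
  simp [QuadraticMap.polar, ← smul_add, hQ]

theorem polarBilin_smul_left (ht : t * t' = 1) (hQ : ∀ v, Q (t • v) = Q v) (u w : V) :
    Q.polarBilin (t • u) w = Q.polarBilin u (t' • w) := by
  conv_lhs => rw [← one_smul B w, ← ht, mul_smul]
  exact polarBilin_smul_smul hQ _ _

theorem polarBilin_inv_smul_left (ht : t * t' = 1) (hQ : ∀ v, Q (t • v) = Q v) (u w : V) :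
    Q.polarBilin (t' • u) w = Q.polarBilin u (t • w) := by
  rw [polarBilin_symm, ← polarBilin_smul_left ht hQ, polarBilin_symm]

theorem map_inv_smul (ht : t * t' = 1) (hQ : ∀ v, Q (t • v) = Q v) (v : V) :
    Q (t' • v) = Q v := by
  rw [← hQ, ← mul_smul, ht, one_smul]

theorem polarBilin_aeval_smul_left (ht : t * t' = 1) (hQ : ∀ v, Q (t • v) = Q v) (r : K[X])
    (u w : V) :
    Q.polarBilin (aeval (t + t') r • u) w = Q.polarBilin u (aeval (t + t') r • w) := by
  have hs (u w : V) : Q.polarBilin ((t + t') • u) w = Q.polarBilin u ((t + t') • w) := by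
    rw [add_smul, add_smul, map_add, map_add, LinearMap.add_apply, polarBilin_smul_left ht hQ,
      polarBilin_inv_smul_left ht hQ, add_comm]
  induction r using Polynomial.induction_on generalizing u w with
  | C a => simp only [aeval_C, algebraMap_smul, map_smul, LinearMap.smul_apply]
  | add p q hp hq =>
    simp only [map_add, add_smul, LinearMap.add_apply, hp, hq]
  | monomial n a h =>
    rw [pow_succ, ← mul_assoc, map_mul, aeval_X, mul_smul, h, hs, smul_smul, mul_comm]

theorem polarBilin_aeval_add_smul_left (ht : t * t' = 1) (hQ : ∀ v, Q (t • v) = Q v)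
    (p q : K[X]) (u w : V) :
    Q.polarBilin ((aeval (t + t') p + aeval (t + t') q * t) • u) w
      = Q.polarBilin u ((aeval (t + t') p + aeval (t + t') q * t') • w) := by
  rw [add_smul, add_smul, map_add, map_add, LinearMap.add_apply,
    polarBilin_aeval_smul_left ht hQ, mul_smul, polarBilin_aeval_smul_left ht hQ,
    polarBilin_smul_left ht hQ, ← mul_smul, mul_comm t']

theorem polarBilin_aeval_smul_self [CharP K 2] (ht : t * t' = 1) (hQ : ∀ v, Q (t • v) = Q v)
    (r : K[X]) (v : V) : Q.polarBilin v (aeval (t + t') r • v) = 0 := by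
  have hs (u : V) : Q.polarBilin u ((t + t') • u) = 0 := by
    rw [add_smul, map_add, ← polarBilin_smul_left ht hQ, polarBilin_symm]
    exact CharTwo.add_self_eq_zero _
  induction r using Polynomial.induction_on' with
  | add p q hp hq => simp only [map_add, add_smul, hp, hq, add_zero]
  | monomial n a =>
    rw [← C_mul_X_pow_eq_monomial, map_mul, aeval_C, mul_smul, algebraMap_smul, map_smul]
    obtain ⟨k, rfl | rfl⟩ := Nat.even_or_odd' n
    · rw [two_mul, pow_add, map_mul, mul_smul, ← polarBilin_aeval_smul_left ht hQ,
        polarBilin_self, smul_zero]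
    · rw [pow_succ, two_mul, pow_add, map_mul, map_mul, mul_assoc, mul_smul,
        ← polarBilin_aeval_smul_left ht hQ, mul_comm, mul_smul, aeval_X, hs, smul_zero]

/-- The linear functional on `K[X]` sending `1` to `Q v` and `X * r` to the value of the polar
form at `v` and `r(t + t') t v`. -/
noncomputable def orbitFunctional (Q : QuadraticForm K V) (t t' : B) (v : V) : K[X] →ₗ[K] K where
  toFun r := r.coeff 0 * Q v + Q.polarBilin v ((aeval (t + t') r.divX * t) • v)
  map_add' p q := by
    simp only [coeff_add, divX_add, map_add, add_mul, add_smul]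
    ring
  map_smul' c p := by
    have : (c • p).divX = c • p.divX := by
      ext n
      simp [coeff_divX]
    simp only [coeff_smul, this, map_smul, smul_mul_assoc, smul_assoc, RingHom.id_apply,
      smul_eq_mul]
    ring

theorem orbitFunctional_C (c : K) (v : V) : orbitFunctional Q t t' v (C c) = c * Q v := by
  simp [orbitFunctional]

theorem orbitFunctional_X_mul (r : K[X]) (v : V) :
    orbitFunctional Q t t' v (X * r) = Q.polarBilin v ((aeval (t + t') r * t) • v) := by
  have : (X * r).divX = r := by
    ext n
    simp [coeff_divX, coeff_X_mul]
  simp only [orbitFunctional, LinearMap.coe_mk, AddHom.coe_mk, this]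
  simp

theorem map_aeval_smul [CharP K 2] (ht : t * t' = 1) (hQ : ∀ v, Q (t • v) = Q v)
    (r : K[X]) (v : V) : Q (aeval (t + t') r • v) = orbitFunctional Q t t' v (r ^ 2) := by
  induction r using Polynomial.induction_on' with
  | add p q hp hq =>
    rw [map_add, add_smul, map_add_polarBilin, hp, hq, polarBilin_aeval_smul_left ht hQ,
      ← mul_smul, ← map_mul, polarBilin_aeval_smul_self ht hQ, CharTwo.add_sq, map_add, add_zero]
  | monomial n a =>
    have h : Q (aeval (t + t') (X ^ n : K[X]) • v)
        = orbitFunctional Q t t' v ((X ^ n) ^ 2) := by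
      cases n with
      | zero =>
        have := orbitFunctional_C (Q := Q) (t := t) (t' := t') 1 v
        simp only [map_one, one_mul] at this
        simp [this]
      | succ n =>
        have e : ((X : K[X]) ^ (n + 1)) ^ 2 = X * (X ^ n * (X ^ n * X)) := by ring
        rw [e, orbitFunctional_X_mul, pow_succ, map_mul, mul_comm, mul_smul]
        rw [map_mul, mul_assoc, mul_smul (aeval (t + t') ((X : K[X]) ^ n)),
          ← polarBilin_aeval_smul_left ht hQ, map_mul, mul_assoc, mul_smul]
        generalize hu : aeval (t + t') ((X : K[X]) ^ n) • v = u
        have e' : (aeval (t + t') ((X : K[X]) ^ n) * (aeval (t + t') (X : K[X]) * t)) • v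
            = u + (t * t) • u := by
          rw [mul_comm, mul_smul, hu, aeval_X, add_mul, mul_comm t' t, ht, add_smul, one_smul,
            add_comm]
        rw [← mul_smul, e', map_add, polarBilin_self, zero_add, aeval_X, add_smul,
          map_add_polarBilin, hQ, map_inv_smul ht hQ, CharTwo.add_self_eq_zero, zero_add,
          polarBilin_symm, polarBilin_inv_smul_left ht hQ, mul_smul]
    rw [← C_mul_X_pow_eq_monomial, map_mul, aeval_C, mul_smul, algebraMap_smul,
      QuadraticMap.map_smul, h, mul_pow, ← C_pow, ← smul_eq_C_mul, map_smul, smul_eq_mul,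
        smul_eq_mul, sq a]

theorem map_add_smul_eq_orbitFunctional [CharP K 2] (ht : t * t' = 1)
    (hQ : ∀ v, Q (t • v) = Q v) (p q : K[X]) (v : V) :
    Q ((aeval (t + t') p + aeval (t + t') q * t) • v)
      = orbitFunctional Q t t' v (p ^ 2 + X * (p * q) + q ^ 2) := by
  rw [add_smul, map_add_polarBilin, map_aeval_smul ht hQ, mul_comm, mul_smul, hQ,
    map_aeval_smul ht hQ, map_add, map_add, orbitFunctional_X_mul,
    polarBilin_aeval_smul_left ht hQ, ← mul_smul, ← mul_smul, map_mul]
  rw [mul_right_comm]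
  ring

theorem orbitFunctional_add [CharP K 2] (ht : t * t' = 1) (hQ : ∀ v, Q (t • v) = Q v)
    (u w : V) (r : K[X]) :
    orbitFunctional Q t t' (u + w) r = orbitFunctional Q t t' u r + orbitFunctional Q t t' w r
      + Q.polarBilin (aeval (t + t') r • u) w := by
  have hX (p : K[X]) :
      orbitFunctional Q t t' (u + w) (X * p) = orbitFunctional Q t t' u (X * p)
      + orbitFunctional Q t t' w (X * p) + Q.polarBilin (aeval (t + t') (X * p) • u) w := by
    simp only [orbitFunctional_X_mul, smul_add, map_add, LinearMap.add_apply]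
    have h1 : Q.polarBilin u ((aeval (t + t') p * t) • w)
        = Q.polarBilin ((aeval (t + t') p * t') • u) w := by
      rw [mul_smul, ← polarBilin_aeval_smul_left ht hQ, ← polarBilin_inv_smul_left ht hQ,
        ← mul_smul, mul_comm]
    have h2 : Q.polarBilin (aeval (t + t') (X * p) • u) w
        = Q.polarBilin ((aeval (t + t') p * t) • u) w
        + Q.polarBilin ((aeval (t + t') p * t') • u) w := by
      rw [← LinearMap.add_apply, ← map_add, ← add_smul, ← mul_add, map_mul, aeval_X, mul_comm]
    rw [h1, h2, polarBilin_symm w]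
    ring
  rw [← divX_mul_X_add r, mul_comm r.divX, map_add, map_add, map_add, hX, orbitFunctional_C,
    orbitFunctional_C, orbitFunctional_C, map_add (aeval (t + t')), add_smul,
    map_add Q.polarBilin, LinearMap.add_apply,
    aeval_C, algebraMap_smul, map_smul Q.polarBilin (r.coeff 0), LinearMap.smul_apply,
    map_add_polarBilin, smul_eq_mul]
  ring

theorem orbitFunctional_smul [CharP K 2] (ht : t * t' = 1) (hQ : ∀ v, Q (t • v) = Q v)
    (p q r : K[X]) (v : V) :
    orbitFunctional Q t t' ((aeval (t + t') p + aeval (t + t') q * t) • v) r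
      = orbitFunctional Q t t' v ((p ^ 2 + X * (p * q) + q ^ 2) * r) := by
  have hX (r : K[X]) :
      orbitFunctional Q t t' ((aeval (t + t') p + aeval (t + t') q * t) • v) (X * r)
      = orbitFunctional Q t t' v ((p ^ 2 + X * (p * q) + q ^ 2) * (X * r)) := by
    rw [mul_left_comm, orbitFunctional_X_mul, orbitFunctional_X_mul]
    rw [polarBilin_aeval_add_smul_left ht hQ, ← mul_smul, ← mul_smul]
    congr 2
    simp only [map_mul, map_add, map_pow, aeval_X]
    linear_combination (aeval (t + t') q) ^ 2 * aeval (t + t') r * t * ht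
  rw [← divX_mul_X_add r, mul_comm r.divX, map_add, hX, orbitFunctional_C,
    map_add_smul_eq_orbitFunctional ht hQ, mul_add, mul_comm _ (C _), ← smul_eq_C_mul,
    map_add _ _ (r.coeff 0 • _), map_smul, smul_eq_mul]

end SelfDual

section Polynomials

variable [Field K]

theorem exists_eq_mul_of_functional {j : ℕ} (F : K[X] →ₗ[K] K)
    (hF : ∀ r, F (X ^ (j + 1) * r) = 0) (hFj : F (X ^ j) ≠ 0) (G : K[X] →ₗ[K] K)
    (hG : ∀ r, G (X ^ (j + 1) * r) = 0) : ∃ a : K[X], ∀ r, G r = F (a * r) := by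
  have key (n : ℕ) (hn : n ≤ j + 1) : ∀ G : K[X] →ₗ[K] K, (∀ r, G (X ^ n * r) = 0) →
      ∃ a : K[X], ∀ r, G r = F (a * r) := by
    clear hG G
    induction n with
    | zero => exact fun G hG => ⟨0, fun r => by simpa using hG r⟩
    | succ n ih =>
      intro G hG
      obtain ⟨i, rfl⟩ : ∃ i, j = i + n := ⟨j - n, by omega⟩
      set c := G (X ^ n) / F (X ^ (i + n)) with hc
      obtain ⟨a, ha⟩ := ih (by omega)
        (G - F ∘ₗ LinearMap.mulLeft K (C c * X ^ i)) (fun r => by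
          rw [LinearMap.sub_apply, LinearMap.comp_apply, LinearMap.mulLeft_apply]
          rw [← divX_mul_X_add r]
          have e1 : X ^ n * (r.divX * X + C (r.coeff 0))
              = X ^ (n + 1) * r.divX + r.coeff 0 • X ^ n := by
            rw [smul_eq_C_mul]; ring
          have e2 : C c * X ^ i * (X ^ n * (r.divX * X + C (r.coeff 0)))
              = X ^ (i + n + 1) * (C c * r.divX) + (r.coeff 0 * c) • X ^ (i + n) := by
            rw [smul_eq_C_mul, C_mul]; ring
          rw [e2, e1, map_add, map_add, hG, hF, map_smul, map_smul, hc, smul_eq_mul, smul_eq_mul]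
          field_simp
          ring)
      refine ⟨C c * X ^ i + a, fun r => ?_⟩
      rw [add_mul, map_add, ← ha]
      simp [mul_assoc]
  exact key _ le_rfl G hG

theorem exists_fixed_point_mod_X_pow (a d e : K[X]) (n : ℕ) :
    ∃ y : K[X], X ^ n ∣ a + X * (d * y + e * y ^ 2) - y := by
  induction n with
  | zero => exact ⟨0, by simp⟩
  | succ n ih =>
    obtain ⟨y, hy⟩ := ih
    refine ⟨a + X * (d * y + e * y ^ 2), ?_⟩
    obtain ⟨w, hw⟩ := hy
    set y' := a + X * (d * y + e * y ^ 2) with hy'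
    refine ⟨w * (d + e * (y' + y)), ?_⟩
    linear_combination (X * (d + e * (y' + y))) * hw - hy'

theorem exists_root_mod_X_pow (a b : K[X]) (ha : a.coeff 0 ≠ 0) (n : ℕ) :
    ∃ r : K[X], r.coeff 0 ≠ 0 ∧ X ^ (n + 1) ∣ a * (r ^ 2 + X * (b * r) + X * b ^ 2) - r := by
  obtain ⟨y, w, hy⟩ := exists_fixed_point_mod_X_pow a (a * b) (a * b ^ 2) (n + 1)
  have hy0 : y.coeff 0 = a.coeff 0 := by
    have := congrArg (coeff · 0) hy
    simp only [coeff_sub, coeff_add, mul_coeff_zero, coeff_X_zero, zero_mul, add_zero,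
      coeff_X_pow, if_neg n.succ_ne_zero.symm] at this
    exact (sub_eq_zero.mp this).symm
  have hcop : IsCoprime y (X ^ (n + 1)) :=
    (((irreducible_X.coprime_iff_not_dvd).2
      (by rw [X_dvd_iff, hy0]; exact ha)).symm).pow_right
  obtain ⟨r, v, hr⟩ := hcop
  refine ⟨r, fun h0 => ?_, r ^ 2 * w + v * (X * a * b * r + X * a * b ^ 2 * (1 + y * r) - r), ?_⟩
  · have := congrArg (coeff · 0) hr
    simp [mul_coeff_zero, h0] at this
  · linear_combination r ^ 2 * hy - (X * a * b * r + X * a * b ^ 2 * (1 + y * r) - r) * hr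

theorem functional_mul_X_pow {j : ℕ} (F : K[X] →ₗ[K] K)
    (hF : ∀ r, F (X ^ (j + 1) * r) = 0) (r : K[X]) :
    F (r * X ^ j) = r.coeff 0 * F (X ^ j) := by
  conv_lhs => rw [← divX_mul_X_add r]
  rw [show (r.divX * X + C (r.coeff 0)) * X ^ j
      = X ^ (j + 1) * r.divX + C (r.coeff 0) * X ^ j by ring, map_add, hF, ← smul_eq_C_mul,
    map_smul, smul_eq_mul, zero_add]

end Polynomials

section NormalPair

variable {B : Type*} [Field K] [AddCommGroup V] [Module K V] [CommRing B] [Algebra K B]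
  [Module B V] [IsScalarTower K B V] {Q : QuadraticForm K V} {t t' : B}

theorem aeval_X_pow_succ_mul_smul [CharP K 2] (ht : t * t' = 1) {j : ℕ}
    (hj : ∀ v : V, ((t + t') ^ j * (1 + t)) • v = 0) (r : K[X]) (v : V) :
    aeval (t + t') (X ^ (j + 1) * r) • v = 0 := by
  rw [← hj ((t' * (1 + t) * aeval (t + t') r) • v), ← mul_smul]
  congr 1
  simp only [map_mul, map_pow, aeval_X]
  linear_combination (-(t + t') ^ j * aeval (t + t') r * (2 + t)) * ht
    + (t + t') ^ j * aeval (t + t') r * (-1) * two_eq_zero_of_algebra (K := K) B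

theorem orbitFunctional_X_pow_succ_mul [CharP K 2] (ht : t * t' = 1)
    (hQ : ∀ v, Q (t • v) = Q v) {j : ℕ} (hj : ∀ v : V, ((t + t') ^ j * (1 + t)) • v = 0)
    (r : K[X]) (v : V) : orbitFunctional Q t t' v (X ^ (j + 1) * r) = 0 := by
  have e : (aeval (t + t') (X ^ j * r) * t) • v
      = ((t + t') ^ j * (1 + t)) • (aeval (t + t') r • v) - aeval (t + t') (X ^ j * r) • v := by
    rw [← mul_smul, ← sub_smul, map_mul, map_pow, aeval_X]
    congr 1
    ring
  rw [pow_succ', mul_assoc, orbitFunctional_X_mul, e, hj, zero_sub, map_neg,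
    polarBilin_aeval_smul_self ht hQ, neg_zero]

/-- The linear functional on `K[X]` sending `r` to the value of the polar form at `r(s) x`
and `z`. -/
noncomputable def crossFunctional (Q : QuadraticForm K V) (s : B) (x z : V) : K[X] →ₗ[K] K where
  toFun r := Q.polarBilin (aeval s r • x) z
  map_add' p q := by simp only [map_add, add_smul, LinearMap.add_apply]
  map_smul' c p := by
    simp only [map_smul, smul_assoc, LinearMap.smul_apply, RingHom.id_apply]

theorem crossFunctional_apply (s : B) (x z : V) (r : K[X]) :
    crossFunctional Q s x z r = Q.polarBilin (aeval s r • x) z := rfl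

theorem exists_orbitFunctional_ne_zero [CharP K 2] (ht : t * t' = 1)
    (hQ : ∀ v, Q (t • v) = Q v) {r : K[X]} {x z : V}
    (hxz : crossFunctional Q (t + t') x z r ≠ 0) :
    ∃ x z, crossFunctional Q (t + t') x z r ≠ 0 ∧ orbitFunctional Q t t' x r ≠ 0 := by
  by_cases hx : orbitFunctional Q t t' x r = 0
  · by_cases hz : orbitFunctional Q t t' z r = 0
    · refine ⟨x + z, z, ?_, ?_⟩
      · rwa [crossFunctional_apply, smul_add, map_add, LinearMap.add_apply,
          polarBilin_symm (_ • z), polarBilin_aeval_smul_self ht hQ, add_zero]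
      · rwa [orbitFunctional_add ht hQ, hx, hz, add_zero, zero_add]
    · refine ⟨z, x, ?_, hz⟩
      rwa [crossFunctional_apply, polarBilin_symm, ← polarBilin_aeval_smul_left ht hQ]
  · exact ⟨x, z, hxz, hx⟩

theorem exists_polarBilin_one_add_smul_eq_zero [CharP K 2] (ht : t * t' = 1)
    (hQ : ∀ v, Q (t • v) = Q v) {j : ℕ} (hj : ∀ v : V, ((t + t') ^ j * (1 + t)) • v = 0)
    {x z : V} (hxz : crossFunctional Q (t + t') x z (X ^ j) ≠ 0) :
    ∃ z, crossFunctional Q (t + t') x z (X ^ j) ≠ 0 ∧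
      ∀ r : K[X], Q.polarBilin ((aeval (t + t') r * (1 + t)) • x) z = 0 := by
  have h2 : (2 : K[X]) = 0 := CharTwo.two_eq_zero
  set F := crossFunctional Q (t + t') x z with hFdef
  set G := crossFunctional Q (t + t') ((1 + t) • x) z with hGdef
  have hF (r) : F (X ^ (j + 1) * r) = 0 := by
    rw [hFdef, crossFunctional_apply, aeval_X_pow_succ_mul_smul ht hj, map_zero,
      LinearMap.zero_apply]
  have hG (r) : G (X ^ j * r) = 0 := by
    rw [hGdef, crossFunctional_apply, ← mul_smul, map_mul, map_pow, aeval_X, mul_right_comm,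
      mul_smul, hj, map_zero, LinearMap.zero_apply]
  obtain ⟨g, hg⟩ := exists_eq_mul_of_functional F hF hxz G (fun r => by
    rw [pow_succ, mul_assoc, hG])
  have hg0 : g.coeff 0 = 0 := by
    have := functional_mul_X_pow F hF g
    rw [← hg, ← mul_one (X ^ j), hG, mul_one] at this
    exact (mul_eq_zero.mp this.symm).resolve_right hxz
  obtain ⟨w, rfl⟩ := X_dvd_iff.mpr hg0
  have hP (p q : K[X]) : Q.polarBilin ((aeval (t + t') p + aeval (t + t') q * (1 + t)) • x) z
      = F (p + X * w * q) := by
    rw [map_add, ← hg, add_smul, map_add, LinearMap.add_apply, mul_smul]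
    rfl
  have hadj (y : V) : Q.polarBilin y
      ((aeval (t + t') (1 + X * w + w) + aeval (t + t') w * t') • z)
      = Q.polarBilin ((aeval (t + t') (1 + X * w + w) + aeval (t + t') w * t) • y) z :=
    (polarBilin_aeval_add_smul_left ht hQ _ _ _ _).symm
  refine ⟨(aeval (t + t') (1 + X * w + w) + aeval (t + t') w * t') • z, ?_, fun r => ?_⟩
  · rw [crossFunctional_apply, hadj, ← mul_smul]
    have e : (aeval (t + t') (1 + X * w + w) + aeval (t + t') w * t)
          * aeval (t + t') (X ^ j : K[X])
        = aeval (t + t') (X ^ j + X ^ (j + 1) * w) + aeval (t + t') (w * X ^ j) * (1 + t) := by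
      simp only [map_add, map_mul, map_pow, aeval_X, map_one]
      ring
    rw [e, hP, show X ^ j + X ^ (j + 1) * w + X * w * (w * X ^ j)
      = X ^ j + X ^ (j + 1) * (w + w * w) by ring, map_add, hF, add_zero]
    exact hxz
  · rw [hadj, ← mul_smul]
    have e : (aeval (t + t') (1 + X * w + w) + aeval (t + t') w * t)
          * (aeval (t + t') r * (1 + t))
        = aeval (t + t') (-(X * w * r)) + aeval (t + t') ((1 + 2 * X * w + 2 * w) * r) * (1 + t)
          - 2 * aeval (t + t') (w * r) := by
      simp only [map_add, map_mul, map_neg, aeval_X, map_one, map_ofNat]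
      linear_combination (-(aeval (t + t') w * aeval (t + t') r)) * ht
    rw [e, two_eq_zero_of_algebra (K := K) B, zero_mul, sub_zero, hP, h2]
    rw [show -(X * w * r) + X * w * ((1 + 0 * X * w + 0 * w) * r) = 0 by ring, map_zero]

theorem exists_orbitFunctional_eq [CharP K 2] (ht : t * t' = 1)
    (hQ : ∀ v, Q (t • v) = Q v) {j : ℕ} (hj : ∀ v : V, ((t + t') ^ j * (1 + t)) • v = 0)
    {x z : V} (hxz : crossFunctional Q (t + t') x z (X ^ j) ≠ 0) :
    ∃ x z, crossFunctional Q (t + t') x z (X ^ j) ≠ 0 ∧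
      (∀ r, orbitFunctional Q t t' x r = orbitFunctional Q t t' z r) ∧
      ∀ r : K[X], Q.polarBilin ((aeval (t + t') r * (1 + t)) • x) z = 0 := by
  have h2 : (2 : K[X]) = 0 := CharTwo.two_eq_zero
  obtain ⟨x, z₀, hxz₀, hx⟩ := exists_orbitFunctional_ne_zero ht hQ hxz
  obtain ⟨z, hxz, hz⟩ := exists_polarBilin_one_add_smul_eq_zero ht hQ hj hxz₀
  set F := crossFunctional Q (t + t') x z with hFdef
  have hF (r) : F (X ^ (j + 1) * r) = 0 := by
    rw [hFdef, crossFunctional_apply, aeval_X_pow_succ_mul_smul ht hj, map_zero,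
      LinearMap.zero_apply]
  obtain ⟨a, ha⟩ := exists_eq_mul_of_functional F hF hxz (orbitFunctional Q t t' x)
    (fun r => orbitFunctional_X_pow_succ_mul ht hQ hj r x)
  obtain ⟨b, hb⟩ := exists_eq_mul_of_functional F hF hxz (orbitFunctional Q t t' z)
    (fun r => orbitFunctional_X_pow_succ_mul ht hQ hj r z)
  have ha0 : a.coeff 0 ≠ 0 := by
    intro h
    rw [ha, functional_mul_X_pow F hF, h, zero_mul] at hx
    exact hx rfl
  obtain ⟨r, hr0, w, hw⟩ := exists_root_mod_X_pow a b ha0 j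
  have hP (p q : K[X]) : Q.polarBilin ((aeval (t + t') p + aeval (t + t') q * t) • x) z
      = F (p + q) := by
    have e : aeval (t + t') p + aeval (t + t') q * t
        = aeval (t + t') (p + q) + aeval (t + t') q * (1 + t) - 2 * aeval (t + t') q := by
      rw [map_add]
      ring
    rw [e, two_eq_zero_of_algebra (K := K) B, zero_mul, sub_zero, add_smul, map_add,
      LinearMap.add_apply, hz, add_zero]
    rfl
  have hcross (p : K[X]) : Q.polarBilin (aeval (t + t') p • z)
      ((aeval (t + t') b + aeval (t + t') (r + b) * t) • x) = F (r * p) := by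
    rw [polarBilin_aeval_smul_left ht hQ, polarBilin_symm, ← mul_smul, mul_add, ← mul_assoc,
      ← map_mul, ← map_mul, hP]
    congr 1
    linear_combination p * b * h2
  refine ⟨z, z + (aeval (t + t') b + aeval (t + t') (r + b) * t) • x, ?_, fun p => ?_,
    fun p => ?_⟩
  · rw [crossFunctional_apply, map_add, hcross, functional_mul_X_pow F hF, polarBilin_symm,
      polarBilin_aeval_smul_self ht hQ, zero_add]
    exact mul_ne_zero hr0 hxz
  · rw [orbitFunctional_add ht hQ, orbitFunctional_smul ht hQ, hcross, ha, add_assoc, ← map_add,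
      show a * ((b ^ 2 + X * (b * (r + b)) + (r + b) ^ 2) * p) + r * p
        = X ^ (j + 1) * (w * p) by
        linear_combination p * hw + (a * b ^ 2 + a * r * b + r) * p * h2, hF, add_zero]
  · have e1 : Q.polarBilin ((aeval (t + t') p * (1 + t)) • z) z = F (b * (X * p)) := by
      rw [← hb, orbitFunctional_X_mul, polarBilin_symm, mul_add, mul_one, add_smul, map_add,
        polarBilin_aeval_smul_self ht hQ, zero_add]
    have e2 : Q.polarBilin ((aeval (t + t') p * (1 + t)) • z)
        ((aeval (t + t') b + aeval (t + t') (r + b) * t) • x)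
        = F (p * (r + b + X * b + (r + b)) + p * b * 2 - p * b * 2) := by
      have e3 (y : V) : Q.polarBilin ((aeval (t + t') p * (1 + t)) • z) y
          = Q.polarBilin ((aeval (t + t') p * (1 + t')) • y) z := by
        rw [mul_add, mul_one, polarBilin_aeval_add_smul_left ht hQ, polarBilin_symm, mul_add,
          mul_one]
      have e4 : aeval (t + t') p * (1 + t')
            * (aeval (t + t') b + aeval (t + t') (r + b) * t)
          = aeval (t + t') (p * (b + (r + b) + X * b)) + aeval (t + t') (p * (r + b - b)) * t := by
        simp only [map_add, map_mul, map_sub, aeval_X]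
        linear_combination aeval (t + t') p * (aeval (t + t') r + aeval (t + t') b) * ht
      rw [e3, ← mul_smul, e4, hP]
      congr 1
      linear_combination (-p * b) * h2 + p * b * h2
    rw [map_add, e1, e2, ← map_add,
      show b * (X * p) + (p * (r + b + X * b + (r + b)) + p * b * 2 - p * b * 2) = 0 by
        linear_combination (b * X * p + p * (r + b)) * h2, map_zero]

end NormalPair

section Decomposition

variable [Field K] [AddCommGroup V] [Module K V] {Q : QuadraticForm K V} {f : V →ₗ[K] V}

theorem mem_cyclicSpan {x u : V} : u ∈ cyclicSpan f x ↔ ∃ P : K[X], aeval f P x = u := by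
  constructor
  · intro hu
    induction hu using Submodule.span_induction with
    | mem u hu =>
      obtain ⟨k, rfl⟩ := hu
      exact ⟨X ^ k, by simp⟩
    | zero => exact ⟨0, by simp⟩
    | add u w _ _ hu hw =>
      obtain ⟨P, rfl⟩ := hu
      obtain ⟨R, rfl⟩ := hw
      exact ⟨P + R, by simp⟩
    | smul c u _ hu =>
      obtain ⟨P, rfl⟩ := hu
      exact ⟨c • P, by simp⟩
  · rintro ⟨P, rfl⟩
    rw [aeval_eq_sum_range, LinearMap.sum_apply]
    exact Submodule.sum_mem _ fun k _ =>
      Submodule.smul_mem _ _ (Submodule.subset_span ⟨k, rfl⟩)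

theorem polarBilin_sub_one_pow (hf : ∀ v, Q (f v) = Q v) (l : ℕ) (u y : V) :
    Q.polarBilin (((f - 1) ^ l) u) ((f ^ l) y) = (-1) ^ l * Q.polarBilin u (((f - 1) ^ l) y) := by
  have h (u w : V) : Q.polarBilin (f u) (f w) = Q.polarBilin u w := by
    simp [QuadraticMap.polar, ← map_add, hf]
  induction l generalizing u y with
  | zero => simp
  | succ l ih =>
    rw [pow_succ', pow_succ' f, Module.End.mul_apply, Module.End.mul_apply, LinearMap.sub_apply,
      map_sub, LinearMap.sub_apply, h, ih, ← pow_succ', pow_succ (f - 1), Module.End.mul_apply,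
      LinearMap.sub_apply, map_sub, map_sub]
    have e : f ((f ^ l) y) = (f ^ l) (f y) := by
      rw [← Module.End.mul_apply, ← Module.End.mul_apply, ← pow_succ', ← pow_succ]
    rw [Module.End.one_apply, e, ih, Module.End.one_apply]
    ring

theorem sub_one_pow_apply_aeval {n : ℕ} (hn : (f - 1) ^ (n + 1) = 0) (P : K[X]) (v : V) :
    ((f - 1) ^ n) (aeval f P v) = P.eval 1 • ((f - 1) ^ n) v := by
  obtain ⟨R, hR⟩ := X_sub_C_dvd_sub_C_eval (a := (1 : K)) (p := P)
  have e : (f - 1) ^ n * aeval f P = P.eval 1 • (f - 1) ^ n := by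
    rw [sub_eq_iff_eq_add.mp hR]
    simp only [map_add, map_mul, map_sub, aeval_X, aeval_C, map_one]
    rw [mul_add, ← mul_assoc, ← pow_succ, hn, zero_mul, zero_add, ← Algebra.commutes,
      ← Algebra.smul_def]
    simp
  rw [← Module.End.mul_apply, e, LinearMap.smul_apply]

theorem X_sub_one_pow_dvd_of_orthogonal (hf : ∀ v, Q (f v) = Q v) {n : ℕ}
    (hn : (f - 1) ^ (n + 1) = 0) {x z : V}
    (hxx : Q.polarBilin (((f - 1) ^ n) x) x = 0) (hzz : Q.polarBilin (((f - 1) ^ n) z) z = 0)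
    (hxz : Q.polarBilin (((f - 1) ^ n) x) z ≠ 0) (hzx : Q.polarBilin (((f - 1) ^ n) z) x ≠ 0)
    {P R : K[X]}
    (hx : ∀ S : K[X], Q.polarBilin (aeval f P x + aeval f R z) (aeval f S x) = 0)
    (hz : ∀ S : K[X], Q.polarBilin (aeval f P x + aeval f R z) (aeval f S z) = 0) :
    (X - C 1) ^ (n + 1) ∣ P ∧ (X - C 1) ^ (n + 1) ∣ R := by
  have key (i : ℕ) (hi : i ≤ n + 1) : (X - C 1) ^ i ∣ P ∧ (X - C 1) ^ i ∣ R := by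
    induction i with
    | zero => simp
    | succ i ih =>
      obtain ⟨⟨P', rfl⟩, ⟨R', rfl⟩⟩ := ih (by omega)
      obtain ⟨l, rfl⟩ : ∃ l, n = l + i := ⟨n - i, by omega⟩
      have hinv (y v : V) : Q.polarBilin (((f - 1) ^ (l + i)) v) ((f ^ l) y)
          = Q.polarBilin (((f - 1) ^ (l + i)) v) y := by
        have e : (f ^ l) (((f - 1) ^ (l + i)) v) = ((f - 1) ^ (l + i)) v := by
          have := sub_one_pow_apply_aeval hn (X ^ l) v
          rw [eval_pow, eval_X, one_pow, one_smul] at this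
          refine Eq.trans ?_ this
          rw [← Module.End.mul_apply, ← Module.End.mul_apply]
          congr 1
          rw [map_pow, aeval_X]
          exact (((Commute.refl f).sub_right (Commute.one_right f)).pow_pow _ _).eq
        have h (v : V) : Q ((f ^ l) v) = Q v := by
          clear * - hf
          induction l with
          | zero => simp
          | succ l ih => rw [pow_succ', Module.End.mul_apply, hf, ih]
        conv_lhs => rw [← e]
        simp [QuadraticMap.polar, ← map_add, h]
      have hsum (y : V) (hy : ∀ S : K[X], Q.polarBilin (aeval f ((X - C 1) ^ i * P') x
          + aeval f ((X - C 1) ^ i * R') z) (aeval f S y) = 0) :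
          P'.eval 1 * Q.polarBilin (((f - 1) ^ (l + i)) x) y
            + R'.eval 1 * Q.polarBilin (((f - 1) ^ (l + i)) z) y = 0 := by
        have h1 := polarBilin_sub_one_pow hf l (aeval f ((X - C 1) ^ i * P') x
          + aeval f ((X - C 1) ^ i * R') z) y
        have h2 := hy ((X - C 1) ^ l)
        rw [show aeval f ((X - C 1 : K[X]) ^ l) = (f - 1) ^ l by simp] at h2
        have h3 (p : K[X]) (v : V) : ((f - 1) ^ l) (aeval f ((X - C 1) ^ i * p) v)
            = p.eval 1 • ((f - 1) ^ (l + i)) v := by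
          rw [← sub_one_pow_apply_aeval hn, map_mul, Module.End.mul_apply, pow_add,
            Module.End.mul_apply]
          simp
        rw [map_add, h3, h3, map_add, LinearMap.add_apply, map_smul, map_smul,
          LinearMap.smul_apply, LinearMap.smul_apply, hinv, hinv] at h1
        rw [h2, mul_zero] at h1
        exact h1
      have h1 := hsum x hx
      have h2 := hsum z hz
      rw [hxx, mul_zero, zero_add] at h1
      rw [hzz, mul_zero, add_zero] at h2
      rw [pow_succ]
      exact ⟨mul_dvd_mul_left _ (dvd_iff_isRoot.mpr ((mul_eq_zero.mp h2).resolve_right hxz)),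
        mul_dvd_mul_left _ (dvd_iff_isRoot.mpr ((mul_eq_zero.mp h1).resolve_right hzx))⟩
  exact key _ le_rfl

theorem isCompl_cyclicSpan [FiniteDimensional K V] (hind : OrthIndec Q f)
    (hf : ∀ v, Q (f v) = Q v) {n : ℕ}
    (hn : (f - 1) ^ (n + 1) = 0) {x z : V}
    (hxx : Q.polarBilin (((f - 1) ^ n) x) x = 0) (hzz : Q.polarBilin (((f - 1) ^ n) z) z = 0)
    (hxz : Q.polarBilin (((f - 1) ^ n) x) z ≠ 0) (hzx : Q.polarBilin (((f - 1) ^ n) z) x ≠ 0) :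
    IsCompl (cyclicSpan f x) (cyclicSpan f z) := by
  have hkill {P : K[X]} (hP : (X - C 1) ^ (n + 1) ∣ P) (v : V) : aeval f P v = 0 := by
    obtain ⟨P, rfl⟩ := hP
    simp [hn]
  have hmem (y : V) : y ∈ cyclicSpan f y := mem_cyclicSpan.mpr ⟨1, by simp⟩
  have hinv (y : V) : Invariant f (cyclicSpan f y) := by
    intro u hu
    obtain ⟨P, rfl⟩ := mem_cyclicSpan.mp hu
    exact mem_cyclicSpan.mpr ⟨X * P, by simp⟩
  constructor
  · rw [Submodule.disjoint_def]
    intro u hux huz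
    obtain ⟨P, rfl⟩ := mem_cyclicSpan.mp hux
    obtain ⟨R, hR⟩ := mem_cyclicSpan.mp huz
    have h0 : aeval f P x + aeval f (-R) z = 0 := by simp [hR]
    exact hkill (X_sub_one_pow_dvd_of_orthogonal hf hn hxx hzz hxz hzx
      (fun S => by rw [h0, map_zero, LinearMap.zero_apply])
      (fun S => by rw [h0, map_zero, LinearMap.zero_apply])).1 x
  · rw [codisjoint_iff]
    by_contra hne
    refine hind ⟨cyclicSpan f x ⊔ cyclicSpan f z, ?_, ?_, ?_, ?_⟩
    · intro u hu
      obtain ⟨a, ha, b, hb, rfl⟩ := Submodule.mem_sup.mp hu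
      rw [map_add]
      exact Submodule.add_mem_sup (hinv x a ha) (hinv z b hb)
    · rw [Module.finrank_pos_iff, Submodule.nontrivial_iff_ne_bot]
      intro hbot
      have hx0 : x ∈ cyclicSpan f x ⊔ cyclicSpan f z := Submodule.mem_sup_left (hmem x)
      rw [hbot, Submodule.mem_bot] at hx0
      rw [hx0, map_zero, map_zero, LinearMap.zero_apply] at hxz
      exact hxz rfl
    · exact Submodule.finrank_lt hne
    · intro u hu horth
      obtain ⟨a, ha, b, hb, rfl⟩ := Submodule.mem_sup.mp hu
      obtain ⟨P, rfl⟩ := mem_cyclicSpan.mp ha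
      obtain ⟨R, rfl⟩ := mem_cyclicSpan.mp hb
      obtain ⟨hP, hR⟩ := X_sub_one_pow_dvd_of_orthogonal hf hn hxx hzz hxz hzx
        (fun S => horth _ (Submodule.mem_sup_left (mem_cyclicSpan.mpr ⟨S, rfl⟩)))
        (fun S => horth _ (Submodule.mem_sup_right (mem_cyclicSpan.mpr ⟨S, rfl⟩)))
      rw [hkill hP, hkill hR, add_zero]

end Decomposition

theorem exists_pow_eq_aeval_add {B : Type*} [Field K] [CommRing B] [Algebra K B] {t t' : B}
    (ht : t * t' = 1) (k : ℕ) :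
    ∃ p q : K[X], t ^ k = aeval (t + t') p + aeval (t + t') q * t := by
  induction k with
  | zero => exact ⟨1, 0, by simp⟩
  | succ k ih =>
    obtain ⟨p, q, h⟩ := ih
    refine ⟨-q, p + X * q, ?_⟩
    rw [pow_succ, h]
    simp only [map_neg, map_add, map_mul, aeval_X]
    linear_combination -aeval (t + t') q * ht

theorem exists_pow_succ_add_pow_eq {B : Type*} [Field K] [CommRing B] [Algebra K B] {t t' : B}
    (ht : t * t' = 1) (k : ℕ) :
    ∃ r : K[X], t ^ (k + 1) + t' ^ k = aeval (t + t') r * (1 + t) := by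
  induction k using Nat.twoStepInduction with
  | zero => exact ⟨1, by simp [add_comm]⟩
  | one =>
    refine ⟨X - 1, ?_⟩
    simp only [map_sub, aeval_X, map_one]
    linear_combination -ht
  | more k h₀ h₁ =>
    obtain ⟨r₀, h₀⟩ := h₀
    obtain ⟨r₁, h₁⟩ := h₁
    refine ⟨X * r₁ - r₀, ?_⟩
    simp only [map_sub, map_mul, aeval_X]
    linear_combination (t + t') * h₁ - h₀ - (t ^ (k + 1) + t' ^ k) * ht

theorem stmt11 [Field K] [AddCommGroup V] [Module K V] [FiniteDimensional K V]
    (Q : QuadraticForm K V) (hQ : Nondefective Q)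
    (hchar : ringChar K = 2) (φ : V ≃ₗ[K] V) (hO : InO Q φ)
    (h1o : IsType1o Q φ.toLinearMap) :
    ∃ x z : V,
      IsCompl (cyclicSpan φ.toLinearMap x) (cyclicSpan φ.toLinearMap z) ∧
      (∀ k : ℕ, polarF Q x ((φ.toLinearMap ^ k) x) = polarF Q z ((φ.toLinearMap ^ k) z)) ∧
      (∀ k : ℕ, 1 ≤ k →
        polarF Q ((φ.toLinearMap ^ k) x) z = polarF Q x ((φ.toLinearMap ^ (k - 1)) z)) ∧
      Q x = Q z := by
  have : CharP K 2 := ringChar.of_eq hchar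
  obtain ⟨_, ⟨hind, -, hmin, -⟩, j, rfl⟩ := h1o
  set f : V →ₗ[K] V := φ.toLinearMap with hfdef
  set g : V →ₗ[K] V := φ.symm.toLinearMap with hgdef
  have hfg : f * g = 1 := by ext v; simp [hfdef, hgdef]
  have hgf : g * f = 1 := by ext v; simp [hfdef, hgdef]
  have hcomm : ∀ a ∈ ({f, g} : Set (Module.End K V)), ∀ b ∈ ({f, g} : Set (Module.End K V)),
      a * b = b * a := by
    rintro a (rfl | rfl) b (rfl | rfl) <;> simp only [hfg, hgf]
  let B := Algebra.adjoin K ({f, g} : Set (Module.End K V))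
  let : CommRing B := Algebra.adjoinCommRingOfComm K hcomm
  let t : B := ⟨f, Algebra.subset_adjoin (Set.mem_insert _ _)⟩
  let t' : B := ⟨g, Algebra.subset_adjoin (Set.mem_insert_of_mem _ rfl)⟩
  have ht : t * t' = 1 := Subtype.ext hfg
  have hpow (k : ℕ) (v : V) : (t - 1) ^ k • v = ((f - 1) ^ k) v := rfl
  have hQt (v : V) : Q (t • v) = Q v := hO v
  have hQt_pow (k : ℕ) (v : V) : Q (t ^ k • v) = Q v := by
    induction k with
    | zero => simp
    | succ k ih => rw [pow_succ', mul_smul, hQt, ih]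
  have h2 : (2 : B) = 0 := two_eq_zero_of_algebra (K := K) B
  have hn : (f - 1) ^ (2 * j + 1) = 0 := by
    have := minpoly.aeval K f
    rw [hmin] at this
    simpa using this
  have hs : t + t' = t' * (t - 1) ^ 2 := by
    linear_combination (-t + 2) * ht + h2
  have hj (v : V) : ((t + t') ^ j * (1 + t)) • v = 0 := by
    have e : (t + t') ^ j * (1 + t) = t' ^ j * (t - 1) ^ (2 * j + 1) := by
      rw [hs, mul_pow, ← pow_mul, pow_succ]
      linear_combination t' ^ j * (t - 1) ^ (2 * j) * h2
    rw [e, mul_smul, hpow, hn, LinearMap.zero_apply, smul_zero]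
  have hsj (v : V) : (t + t') ^ j • v = ((f - 1) ^ (2 * j)) v := by
    obtain ⟨c, hc⟩ := sub_one_dvd_pow_sub_one t j
    have e : (t + t') ^ j = (t - 1) ^ (2 * j) - c * ((t + t') ^ j * (1 + t)) := by
      have e' : (t - 1) ^ (2 * j) = t ^ j * (t + t') ^ j := by
        rw [pow_mul, ← mul_pow, hs, ← mul_assoc, ht, one_mul]
      rw [e']
      linear_combination (-(t + t') ^ j) * hc + c * (t + t') ^ j * h2
    rw [e, sub_smul, mul_smul c, hj, smul_zero, sub_zero, hpow]
  obtain ⟨x₀, hx₀⟩ : ∃ v, ((f - 1) ^ (2 * j)) v ≠ 0 := by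
    by_contra! h
    have h0 : aeval f ((X - 1 : K[X]) ^ (2 * j)) = 0 := by
      ext v
      simpa using h v
    have hd := minpoly.dvd K f h0
    rw [hmin, ← C_1, pow_dvd_pow_iff (X_sub_C_ne_zero 1) (not_isUnit_X_sub_C 1)] at hd
    omega
  obtain ⟨z₀, hz₀⟩ : ∃ z, Q.polarBilin (((f - 1) ^ (2 * j)) x₀) z ≠ 0 := by
    by_contra! h
    exact hx₀ (hQ _ h)
  have hX (v : V) : aeval (t + t') (X ^ j : K[X]) • v = ((f - 1) ^ (2 * j)) v := by
    rw [map_pow, aeval_X, hsj]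
  obtain ⟨x, z, hxz, horb, hzero⟩ := exists_orbitFunctional_eq ht hQt hj (x := x₀) (z := z₀)
    (by rwa [crossFunctional_apply, hX])
  have hself (v : V) : Q.polarBilin (((f - 1) ^ (2 * j)) v) v = 0 := by
    rw [← hX, polarBilin_symm, polarBilin_aeval_smul_self ht hQt]
  rw [crossFunctional_apply] at hxz
  refine ⟨x, z, isCompl_cyclicSpan hind hO hn (hself x) (hself z) (by rwa [← hX]) ?_,
    fun k => ?_, fun k hk => ?_, ?_⟩
  · rwa [← hX, polarBilin_aeval_smul_left ht hQt, polarBilin_symm]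
  · obtain ⟨p, q, hpq⟩ := exists_pow_eq_aeval_add (K := K) ht k
    have h (v : V) : polarF Q v ((f ^ k) v) = orbitFunctional Q t t' v (X * q) := by
      change Q.polarBilin v (t ^ k • v) = _
      rw [hpq, add_smul, map_add, polarBilin_aeval_smul_self ht hQt, zero_add,
        orbitFunctional_X_mul]
    rw [h, h, horb]
  · obtain ⟨k, rfl⟩ := Nat.exists_eq_succ_of_ne_zero (Nat.one_le_iff_ne_zero.mp hk)
    obtain ⟨r, hr⟩ := exists_pow_succ_add_pow_eq (K := K) ht k
    have hadj (v : V) : Q.polarBilin (t' ^ k • v) z = Q.polarBilin v (t ^ k • z) := by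
      have e : t ^ k • t' ^ k • v = v := by rw [← mul_smul, ← mul_pow, ht, one_pow, one_smul]
      conv_rhs => rw [← e]
      rw [polarBilin_smul_smul (hQt_pow k)]
    have h := hzero r
    rw [← hr, add_smul, map_add, LinearMap.add_apply, hadj] at h
    exact CharTwo.add_eq_zero.mp h
  · have h := horb (C 1)
    rwa [orbitFunctional_C, orbitFunctional_C, one_mul, one_mul] at h
end

section
/- Suppose char K = 2, φ ∈ O(V,Q) is of type 1o, and σ ∈ O(V,Q) satisfies σ² = 1 and σφσ = φ⁻¹. Then V is a direct sum V = U ⊕ W of two nonzero subspaces U, W that are both φ-invariant and σ-invariant if and only if σ ∈ SO(V,Q). -/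
open Polynomial Module

variable {K V : Type*}

section Helpers

variable [Field K] [AddCommGroup V] [Module K V]

theorem add_self_of_two_eq_zero (h : (2 : K) = 0) (v : V) : v + v = 0 := by
  rw [← two_smul K, h, zero_smul]

/-- The data of a bicyclic unipotent isometry `φ` with odd exponent `2 * j + 1` in characteristic
two, in terms of `N = φ - 1` and its adjoint `N' = φ⁻¹ - 1`; the vectors `x`, `z` generate `V`. -/
structure IsOddBlock (Q : QuadraticForm K V) (N N' : End K V) (j : ℕ) (x z : V) : Prop where
  two : (2 : K) = 0
  nondeg : ∀ u, (∀ w, Q.polarBilin u w = 0) → u = 0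
  adj : ∀ u v, Q.polarBilin (N u) v = Q.polarBilin u (N' v)
  mul_eq : N * N' = N + N'
  mul_eq' : N' * N = N + N'
  quad : ∀ p, Q (N p) = Q.polarBilin p (N p)
  pow_eq_zero : N ^ (2 * j + 1) = 0
  pow_ne_zero : N ^ (2 * j) ≠ 0
  span : ∀ v, ∃ (a b : K) (y : V), v = a • x + b • z + N y

/-- The bilinear form `(u, v) ↦ f_Q((N N')^j u, v)`. -/
def topForm (Q : QuadraticForm K V) (N N' : End K V) (j : ℕ) : LinearMap.BilinForm K V :=
  Q.polarBilin ∘ₗ ((N * N') ^ j)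

theorem topForm_apply (Q : QuadraticForm K V) (N N' : End K V) (j : ℕ) (u v : V) :
    topForm Q N N' j u v = Q.polarBilin (((N * N') ^ j) u) v := rfl

theorem polarBilin_comm (Q : QuadraticForm K V) (u v : V) :
    Q.polarBilin u v = Q.polarBilin v u :=
  QuadraticMap.polar_comm Q u v

namespace IsOddBlock

variable {Q : QuadraticForm K V} {N N' : End K V} {j : ℕ} {x z : V}

theorem commute (H : IsOddBlock Q N N' j x z) : Commute N N' :=
  H.mul_eq.trans H.mul_eq'.symm

theorem add_self (H : IsOddBlock Q N N' j x z) (v : V) : v + v = 0 :=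
  add_self_of_two_eq_zero H.two v

theorem mul_eq_sq (H : IsOddBlock Q N N' j x z) : N * N' = N ^ 2 * (N' - 1) := by
  have h : N * N' * N = N * N' + N * N := by
    ext v
    have h1 := congrArg (fun g : End K V => N (g v)) H.mul_eq'
    simp only [Module.End.mul_apply, LinearMap.add_apply, map_add] at h1 ⊢
    rw [h1, add_comm]
  have h' : N ^ 2 * N' = N * N' + N * N := by
    rw [pow_two, mul_assoc, H.mul_eq, mul_add, H.mul_eq, add_comm]
  rw [mul_sub, h', mul_one, pow_two, add_sub_cancel_right]

theorem sub_one_mul_sub_one (H : IsOddBlock Q N N' j x z) : (N - 1) * (N' - 1) = 1 := by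
  rw [sub_mul, mul_sub, H.mul_eq]
  simp

theorem mul_pow_eq (H : IsOddBlock Q N N' j x z) (i : ℕ) :
    (N * N') ^ i = N ^ (2 * i) * (N' - 1) ^ i := by
  have hc : Commute (N ^ 2) (N' - 1) :=
    (H.commute.pow_left 2).sub_right (Commute.one_right _)
  rw [H.mul_eq_sq, hc.mul_pow, pow_mul]

theorem pow_eq_mul_pow (H : IsOddBlock Q N N' j x z) (i : ℕ) :
    N ^ (2 * i) = (N * N') ^ i * (N - 1) ^ i := by
  have hc : Commute (N - 1) (N' - 1) :=
    (H.commute.sub_right (Commute.one_right _)).sub_left (Commute.one_left _)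
  rw [H.mul_pow_eq, mul_assoc, ← hc.symm.mul_pow, ← hc.eq, H.sub_one_mul_sub_one, one_pow, mul_one]

theorem commute_mul_pow (H : IsOddBlock Q N N' j x z) (i : ℕ) : Commute N ((N * N') ^ i) :=
  ((Commute.refl N).mul_right H.commute).pow_right i

theorem commute_mul_pow' (H : IsOddBlock Q N N' j x z) (i : ℕ) : Commute N' ((N * N') ^ i) :=
  (H.commute.symm.mul_right (Commute.refl N')).pow_right i

theorem top_ne_zero (H : IsOddBlock Q N N' j x z) : (N * N') ^ j ≠ 0 := fun h =>
  H.pow_ne_zero (by rw [H.pow_eq_mul_pow, h, zero_mul])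

theorem mul_top (H : IsOddBlock Q N N' j x z) : N * (N * N') ^ j = 0 := by
  rw [H.mul_pow_eq, ← mul_assoc, ← pow_succ', H.pow_eq_zero, zero_mul]

theorem apply_top (H : IsOddBlock Q N N' j x z) (v : V) : N (((N * N') ^ j) v) = 0 :=
  congrArg (fun g : End K V => g v) H.mul_top

theorem top_apply (H : IsOddBlock Q N N' j x z) (v : V) : ((N * N') ^ j) (N v) = 0 := by
  rw [← Module.End.mul_apply, ← (H.commute_mul_pow j).eq, H.mul_top, LinearMap.zero_apply]

theorem apply_add_apply (H : IsOddBlock Q N N' j x z) (v : V) : N v + N' v = N (N' v) :=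
  (congrArg (fun g : End K V => g v) H.mul_eq).symm

theorem apply_add_apply' (H : IsOddBlock Q N N' j x z) (v : V) : N v + N' v = N' (N v) :=
  (congrArg (fun g : End K V => g v) H.mul_eq').symm

theorem adjoint_apply_of_apply_eq_zero (H : IsOddBlock Q N N' j x z) {v : V} (hv : N v = 0) :
    N' v = 0 := by
  simpa [hv] using H.apply_add_apply' v

theorem top_apply' (H : IsOddBlock Q N N' j x z) (v : V) : ((N * N') ^ j) (N' v) = 0 := by
  rw [← Module.End.mul_apply, ← (H.commute_mul_pow' j).eq]
  exact H.adjoint_apply_of_apply_eq_zero (H.apply_top v)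

theorem adj' (H : IsOddBlock Q N N' j x z) (u v : V) :
    Q.polarBilin (N' u) v = Q.polarBilin u (N v) := by
  rw [polarBilin_comm, ← H.adj, polarBilin_comm]

theorem polarBilin_self (H : IsOddBlock Q N N' j x z) (v : V) : Q.polarBilin v v = 0 := by
  rw [QuadraticMap.polarBilin_apply_apply, QuadraticMap.polar_self, two_nsmul, ← two_mul, H.two,
    zero_mul]

theorem polarBilin_pow (H : IsOddBlock Q N N' j x z) (i : ℕ) (u v : V) :
    Q.polarBilin ((N ^ i) u) v = Q.polarBilin u ((N' ^ i) v) := by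
  induction i generalizing v with
  | zero => simp
  | succ i ih => rw [pow_succ', Module.End.mul_apply, H.adj, ih, pow_succ, Module.End.mul_apply]

theorem polarBilin_mul_pow (H : IsOddBlock Q N N' j x z) (i : ℕ) (u v : V) :
    Q.polarBilin (((N * N') ^ i) u) v = Q.polarBilin u (((N * N') ^ i) v) := by
  induction i generalizing v with
  | zero => simp
  | succ i ih =>
    rw [pow_succ', Module.End.mul_apply, Module.End.mul_apply, H.adj, H.adj', ih,
      ← pow_succ', pow_succ, Module.End.mul_apply, Module.End.mul_apply]

theorem topForm_self (H : IsOddBlock Q N N' j x z) (v : V) : topForm Q N N' j v v = 0 := by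
  rw [topForm_apply, H.commute.mul_pow, H.commute.pow_pow j j |>.eq, Module.End.mul_apply,
    ← polarBilin_comm, ← H.polarBilin_pow, H.polarBilin_self]

theorem topForm_swap (H : IsOddBlock Q N N' j x z) (u v : V) :
    topForm Q N N' j u v = topForm Q N N' j v u := by
  rw [topForm_apply, H.polarBilin_mul_pow, polarBilin_comm, topForm_apply]

theorem topForm_apply_left (H : IsOddBlock Q N N' j x z) (u v : V) :
    topForm Q N N' j (N u) v = 0 := by
  rw [topForm_apply, H.top_apply, map_zero, LinearMap.zero_apply]

theorem topForm_apply_right (H : IsOddBlock Q N N' j x z) (u v : V) :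
    topForm Q N N' j u (N v) = 0 := by
  rw [H.topForm_swap, H.topForm_apply_left]

theorem topForm_generators_ne_zero (H : IsOddBlock Q N N' j x z) :
    topForm Q N N' j x z ≠ 0 := by
  intro h
  refine H.top_ne_zero (LinearMap.ext fun u => H.nondeg _ fun w => ?_)
  obtain ⟨a, b, y, rfl⟩ := H.span u
  obtain ⟨c, d, y', rfl⟩ := H.span w
  rw [← topForm_apply]
  simp [H.topForm_self, H.topForm_apply_left, H.topForm_apply_right, h, H.topForm_swap z x]

theorem span_of_topForm_ne_zero (H : IsOddBlock Q N N' j x z) {p q : V}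
    (hpq : topForm Q N N' j p q ≠ 0) (v : V) :
    ∃ (a b : K) (y : V), v = a • p + b • q + N y := by
  obtain ⟨α, β, p', rfl⟩ := H.span p
  obtain ⟨γ, δ, q', rfl⟩ := H.span q
  obtain ⟨a, b, y, rfl⟩ := H.span v
  have h2 := H.two
  have h : topForm Q N N' j (α • x + β • z + N p') (γ • x + δ • z + N q')
      = (α * δ - β * γ) * topForm Q N N' j x z := by
    simp only [map_add, map_smul, LinearMap.add_apply, LinearMap.smul_apply, H.topForm_self,
      H.topForm_apply_left, H.topForm_apply_right, H.topForm_swap z x, smul_eq_mul]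
    linear_combination (β * γ * topForm Q N N' j x z) * h2
  have hd : α * δ - β * γ ≠ 0 := fun h0 => hpq (by rw [h, h0, zero_mul])
  set d := α * δ - β * γ with hdd
  have hdi : d⁻¹ * (α * δ - β * γ) = 1 := inv_mul_cancel₀ hd
  refine ⟨d⁻¹ * (a * δ - b * γ), d⁻¹ * (b * α - a * β),
    y - (d⁻¹ * (a * δ - b * γ)) • p' - (d⁻¹ * (b * α - a * β)) • q', ?_⟩
  simp only [map_sub, map_smul]
  linear_combination (norm := module) (-hdi) • (a • x + b • z)

theorem exists_topForm_ne_zero (H : IsOddBlock Q N N' j x z) {w : V}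
    (hw : w ∉ LinearMap.range N) : ∃ w', topForm Q N N' j w w' ≠ 0 := by
  by_contra! h
  obtain ⟨a, b, y, rfl⟩ := H.span w
  have h1 := h x
  have h2 := h z
  simp only [map_add, map_smul, LinearMap.add_apply, LinearMap.smul_apply, H.topForm_self,
      H.topForm_apply_left, H.topForm_swap z x, smul_eq_mul, mul_zero, add_zero, zero_add,
      mul_eq_zero, H.topForm_generators_ne_zero, or_false] at h1 h2
  exact hw ⟨y, by simp [h1, h2]⟩

theorem eq_of_apply_eq_zero (H : IsOddBlock Q N N' j x z) {p q u v : V}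
    (hpq : topForm Q N N' j p q ≠ 0) (hu : N u = 0) (hv : N v = 0)
    (h1 : Q.polarBilin u p = Q.polarBilin v p) (h2 : Q.polarBilin u q = Q.polarBilin v q) :
    u = v := by
  refine sub_eq_zero.1 (H.nondeg _ fun w => ?_)
  obtain ⟨a, b, y, rfl⟩ := H.span_of_topForm_ne_zero hpq w
  simp only [map_add, map_smul, map_sub, LinearMap.sub_apply, ← H.adj', h1, h2,
    H.adjoint_apply_of_apply_eq_zero hu, H.adjoint_apply_of_apply_eq_zero hv, sub_self,
    LinearMap.zero_apply, map_zero, smul_zero, add_zero]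

theorem exists_top_of_apply_eq_zero (H : IsOddBlock Q N N' j x z) {u : V} (hu : N u = 0) :
    ∃ a b : K, u = a • ((N * N') ^ j) x + b • ((N * N') ^ j) z := by
  have h0 := H.topForm_generators_ne_zero
  refine ⟨Q.polarBilin u z / topForm Q N N' j x z, Q.polarBilin u x / topForm Q N N' j x z,
    H.eq_of_apply_eq_zero h0 hu (by simp [H.apply_top]) ?_ ?_⟩
  all_goals
    simp only [map_add, map_smul, LinearMap.add_apply, LinearMap.smul_apply, ← topForm_apply,
      H.topForm_self, H.topForm_swap z x, smul_eq_mul, mul_zero, add_zero, zero_add]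
    rw [div_mul_cancel₀ _ h0]

theorem exists_smul_top (H : IsOddBlock Q N N' j x z) {u w : V} (hu : N u = 0)
    (hw : w ∉ LinearMap.range N) (huw : Q.polarBilin u w = 0) :
    ∃ c : K, u = c • ((N * N') ^ j) w := by
  obtain ⟨w', h0⟩ := H.exists_topForm_ne_zero hw
  refine ⟨Q.polarBilin u w' / topForm Q N N' j w w',
    H.eq_of_apply_eq_zero h0 hu (by simp [H.apply_top]) ?_ ?_⟩
  · simp only [map_smul, LinearMap.smul_apply, ← topForm_apply, H.topForm_self, smul_zero, huw]
  · simp only [map_smul, LinearMap.smul_apply, ← topForm_apply, smul_eq_mul]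
    rw [div_mul_cancel₀ _ h0]

theorem range_top (H : IsOddBlock Q N N' j x z) :
    LinearMap.range ((N * N') ^ j) = LinearMap.ker N := by
  refine le_antisymm ?_ fun u hu => ?_
  · rintro _ ⟨v, rfl⟩
    exact H.apply_top v
  · obtain ⟨a, b, rfl⟩ := H.exists_top_of_apply_eq_zero hu
    exact ⟨a • x + b • z, by simp⟩

theorem quad_of_apply_eq_zero (H : IsOddBlock Q N N' j x z) (hj : 1 ≤ j) {u : V}
    (hu : N u = 0) : Q u = 0 := by
  rw [← LinearMap.mem_ker, ← H.range_top] at hu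
  obtain ⟨y, rfl⟩ := hu
  obtain ⟨i, rfl⟩ : ∃ i, j = i + 1 := ⟨j - 1, by omega⟩
  have h : ((N * N') ^ (i + 1)) y = N (N' (((N * N') ^ i) y)) := by
    rw [pow_succ']; rfl
  rw [h, H.quad, ← h, ← H.polarBilin_mul_pow, H.top_apply', map_zero, LinearMap.zero_apply]

theorem finrank_ker (H : IsOddBlock Q N N' j x z) : finrank K (LinearMap.ker N) = 2 := by
  have h0 := H.topForm_generators_ne_zero
  have hli : LinearIndependent K ![((N * N') ^ j) x, ((N * N') ^ j) z] := by
    rw [LinearIndependent.pair_iff]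
    intro a b hab
    have h1 := congrArg (fun v => Q.polarBilin v x) hab
    have h2 := congrArg (fun v => Q.polarBilin v z) hab
    simp only [map_add, map_smul, LinearMap.add_apply, LinearMap.smul_apply, ← topForm_apply,
      H.topForm_self, H.topForm_swap z x, smul_eq_mul, mul_zero, add_zero, zero_add, map_zero,
      LinearMap.zero_apply, mul_eq_zero, h0, or_false] at h1 h2
    exact ⟨h2, h1⟩
  have hs : LinearMap.ker N =
      Submodule.span K (Set.range ![((N * N') ^ j) x, ((N * N') ^ j) z]) := by
    rw [Matrix.range_cons, Matrix.range_cons, Matrix.range_empty, Set.union_empty,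
      Set.singleton_union]
    ext u
    rw [Submodule.mem_span_pair]
    constructor
    · intro hu
      obtain ⟨a, b, rfl⟩ := H.exists_top_of_apply_eq_zero hu
      exact ⟨a, b, rfl⟩
    · rintro ⟨a, b, rfl⟩
      simp [H.apply_top]
  rw [hs, finrank_span_eq_card hli, Fintype.card_fin]

end IsOddBlock

theorem finrank_map_add_finrank_inf_ker [FiniteDimensional K V] (g : End K V)
    (P : Submodule K V) :
    finrank K (P.map g) + finrank K (P ⊓ LinearMap.ker g : Submodule K V) = finrank K P := by
  have h := LinearMap.finrank_range_add_finrank_ker (g.domRestrict P)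
  rw [LinearMap.range_domRestrict, LinearMap.ker_domRestrict] at h
  rwa [← Submodule.map_comap_subtype, Submodule.finrank_map_subtype_eq]

theorem finrank_le_of_finrank_inf_ker_le_one [FiniteDimensional K V] {N : End K V} {m : ℕ}
    (hN : N ^ m = 0) {P : Submodule K V} (hP : ∀ p ∈ P, N p ∈ P)
    (h1 : finrank K (P ⊓ LinearMap.ker N : Submodule K V) ≤ 1) : finrank K P ≤ m := by
  have hmem : ∀ i, P.map (N ^ i) ≤ P := by
    intro i
    induction i with
    | zero => simp [Module.End.one_eq_id]
    | succ i ih =>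
      rw [pow_succ', Module.End.mul_eq_comp, Submodule.map_comp]
      rintro _ ⟨p, hp, rfl⟩
      exact hP p (ih hp)
  have h : ∀ i, finrank K P ≤ i + finrank K (P.map (N ^ i)) := by
    intro i
    induction i with
    | zero => rw [pow_zero, Module.End.one_eq_id, Submodule.map_id, zero_add]
    | succ i ih =>
      have h2 := finrank_map_add_finrank_inf_ker N (P.map (N ^ i))
      have h3 := Submodule.finrank_mono (inf_le_inf_right (LinearMap.ker N) (hmem i))
      rw [pow_succ', Module.End.mul_eq_comp, Submodule.map_comp]
      omega
  have hm := h m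
  rwa [hN, Submodule.map_zero, finrank_bot, add_zero] at hm

theorem cyclicSpan_le {f : V →ₗ[K] V} {x : V} {P : Submodule K V} (hx : x ∈ P)
    (hP : ∀ p ∈ P, f p ∈ P) : cyclicSpan f x ≤ P := by
  refine Submodule.span_le.2 ?_
  rintro _ ⟨i, rfl⟩
  induction i with
  | zero => exact hx
  | succ i ih =>
    simp only [pow_succ', Module.End.mul_apply]
    exact hP _ ih

theorem self_mem_cyclicSpan (f : V →ₗ[K] V) (x : V) : x ∈ cyclicSpan f x :=
  Submodule.subset_span ⟨0, by simp⟩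

theorem apply_mem_cyclicSpan {f : V →ₗ[K] V} {x p : V} (hp : p ∈ cyclicSpan f x) :
    f p ∈ cyclicSpan f x := by
  have h : cyclicSpan f x ≤ (cyclicSpan f x).comap f := by
    refine Submodule.span_le.2 ?_
    rintro _ ⟨i, rfl⟩
    refine Submodule.subset_span ⟨i + 1, ?_⟩
    simp only [pow_succ', Module.End.mul_apply]
  exact h hp

theorem finrank_cyclicSpan_le {f : V →ₗ[K] V} {m : ℕ} (hf : f ^ m = 0) (x : V) :
    finrank K (cyclicSpan f x) ≤ m := by
  have h : cyclicSpan f x = Submodule.span K (Set.range fun i : Fin m => (f ^ (i : ℕ)) x) := by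
    refine le_antisymm (Submodule.span_le.2 ?_) (Submodule.span_mono ?_)
    · rintro _ ⟨i, rfl⟩
      by_cases hi : i < m
      · exact Submodule.subset_span ⟨⟨i, hi⟩, rfl⟩
      · simp only [pow_eq_zero_of_le (not_lt.1 hi) hf, LinearMap.zero_apply]
        exact zero_mem _
    · rintro _ ⟨i, rfl⟩
      exact ⟨i, rfl⟩
  have hle := finrank_range_le_card (R := K) fun i : Fin m => (f ^ (i : ℕ)) x
  rwa [Set.finrank, ← h, Fintype.card_fin] at hle

/-- `s` is an isometric involution conjugating `N = φ - 1` to `N' = φ⁻¹ - 1`. -/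
structure IsInverting (Q : QuadraticForm K V) (N N' s : End K V) : Prop where
  involutive : ∀ v, s (s v) = v
  apply_comm : ∀ v, s (N v) = N' (s v)
  quad : ∀ v, Q (s v) = Q v

theorem IsInverting.apply_comm' {Q : QuadraticForm K V} {N N' s : End K V}
    (hs : IsInverting Q N N' s) (v : V) : s (N' v) = N (s v) := by
  rw [← hs.involutive (N (s v)), hs.apply_comm, hs.involutive]

theorem IsInverting.apply_mul_pow {Q : QuadraticForm K V} {N N' s : End K V}
    (hs : IsInverting Q N N' s) (hc : Commute N N') (i : ℕ) (v : V) :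
    s (((N * N') ^ i) v) = ((N * N') ^ i) (s v) := by
  induction i with
  | zero => simp
  | succ i ih =>
    rw [pow_succ', Module.End.mul_apply, Module.End.mul_apply, hs.apply_comm, hs.apply_comm', ih]
    exact congrArg (fun g : End K V => g (((N * N') ^ i) (s v))) hc.eq.symm

namespace IsOddBlock

variable {Q : QuadraticForm K V} {N N' : End K V} {j : ℕ} {x z : V}

theorem finrank_eq [FiniteDimensional K V] (H : IsOddBlock Q N N' j x z) :
    finrank K V = 2 * (2 * j + 1) := by
  have hle : ∀ i ≤ 2 * j, LinearMap.ker N ≤ LinearMap.range (N ^ i) := by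
    intro i hi
    rw [← H.range_top, H.mul_pow_eq, ← Nat.add_sub_cancel' hi, pow_add, mul_assoc]
    exact LinearMap.range_comp_le_range _ _
  have h : ∀ i ≤ 2 * j + 1, finrank K V = 2 * i + finrank K (LinearMap.range (N ^ i)) := by
    intro i
    induction i with
    | zero => rw [pow_zero, Module.End.one_eq_id, LinearMap.range_id, finrank_top]; simp
    | succ i ih =>
      intro hi
      have h2 := finrank_map_add_finrank_inf_ker N (LinearMap.range (N ^ i))
      rw [inf_eq_right.2 (hle i (by omega)), H.finrank_ker, ← LinearMap.range_comp,
        ← Module.End.mul_eq_comp, ← pow_succ'] at h2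
      have := ih (by omega)
      omega
  have hm := h _ le_rfl
  rwa [H.pow_eq_zero, LinearMap.range_zero, finrank_bot, add_zero] at hm

theorem sup_eq_top (H : IsOddBlock Q N N' j x z) {p q : V}
    (hpq : topForm Q N N' j p q ≠ 0) {P : Submodule K V} (hp : p ∈ P) (hq : q ∈ P)
    (hP : ∀ v ∈ P, N v ∈ P) : P = ⊤ := by
  have h : ∀ i v, ∃ r ∈ P, ∃ y, v = r + (N ^ i) y := by
    intro i
    induction i with
    | zero => exact fun v => ⟨0, zero_mem _, v, by simp⟩
    | succ i ih =>
      intro v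
      obtain ⟨a, b, y, rfl⟩ := H.span_of_topForm_ne_zero hpq v
      obtain ⟨r, hr, y', rfl⟩ := ih y
      refine ⟨a • p + b • q + N r,
        add_mem (add_mem (P.smul_mem _ hp) (P.smul_mem _ hq)) (hP _ hr), y', ?_⟩
      rw [pow_succ', Module.End.mul_apply, map_add, add_assoc _ (N r)]
  refine eq_top_iff.2 fun v _ => ?_
  obtain ⟨r, hr, y, rfl⟩ := h (2 * j + 1) v
  simpa [H.pow_eq_zero] using hr

theorem isCompl_cyclicSpan [FiniteDimensional K V] (H : IsOddBlock Q N N' j x z) {p q : V}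
    (hpq : topForm Q N N' j p q ≠ 0) : IsCompl (cyclicSpan N p) (cyclicSpan N q) := by
  have ht : cyclicSpan N p ⊔ cyclicSpan N q = ⊤ := by
    refine H.sup_eq_top hpq (Submodule.mem_sup_left (self_mem_cyclicSpan N p))
      (Submodule.mem_sup_right (self_mem_cyclicSpan N q)) fun v hv => ?_
    obtain ⟨a, ha, b, hb, rfl⟩ := Submodule.mem_sup.1 hv
    rw [map_add]
    exact Submodule.add_mem_sup (apply_mem_cyclicSpan ha) (apply_mem_cyclicSpan hb)
  refine ⟨disjoint_iff.2 (Submodule.finrank_eq_zero.1 ?_), codisjoint_iff.2 ht⟩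
  have h := Submodule.finrank_sup_add_finrank_inf_eq (cyclicSpan N p) (cyclicSpan N q)
  have h1 := finrank_cyclicSpan_le H.pow_eq_zero p
  have h2 := finrank_cyclicSpan_le H.pow_eq_zero q
  rw [ht, finrank_top, H.finrank_eq] at h
  omega

theorem adjoint_mem (H : IsOddBlock Q N N' j x z) {P : Submodule K V}
    (hP : ∀ p ∈ P, N p ∈ P) {p : V} (hp : p ∈ P) : N' p ∈ P := by
  have h : ∀ i, ∃ r ∈ P, N' p = r + (N ^ i) (N' p) := by
    intro i
    induction i with
    | zero => exact ⟨0, zero_mem _, by simp⟩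
    | succ i ih =>
      obtain ⟨r, hr, h⟩ := ih
      refine ⟨N r - N p, sub_mem (hP _ hr) (hP _ hp), ?_⟩
      rw [pow_succ', Module.End.mul_apply, sub_add_eq_add_sub, ← map_add, ← h,
        ← H.apply_add_apply, add_sub_cancel_left]
  obtain ⟨r, hr, h⟩ := h (2 * j + 1)
  rw [H.pow_eq_zero, LinearMap.zero_apply, add_zero] at h
  rwa [h]

theorem exists_fixed (H : IsOddBlock Q N N' j x z) (hj : 1 ≤ j) {s : End K V}
    (hs : IsInverting Q N N' s) {w u : V} (hw : s w = w + u) (hu : N u = 0) :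
    ∃ y, s (w + N y) = w + N y := by
  by_cases hwN : w ∈ LinearMap.range N
  · obtain ⟨y, rfl⟩ := hwN
    exact ⟨-y, by simp⟩
  have h0 : Q.polarBilin u w = 0 := by
    have h1 := hs.quad w
    have h2 : Q (w + u) - Q w - Q u = Q.polarBilin w u := rfl
    rw [polarBilin_comm, ← h2, ← hw, h1, H.quad_of_apply_eq_zero hj hu]
    ring
  obtain ⟨c, rfl⟩ := H.exists_smul_top hu hwN h0
  obtain ⟨i, rfl⟩ : ∃ i, j = i + 1 := ⟨j - 1, by omega⟩
  have h1 : ((N * N') ^ (i + 1)) w = N (((N * N') ^ i) w) + N' (((N * N') ^ i) w) := by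
    rw [H.apply_add_apply, pow_succ']; rfl
  have h2 : N' (((N * N') ^ i) (((N * N') ^ (i + 1)) w)) = 0 := by
    rw [← Module.End.mul_apply N', (H.commute_mul_pow' i).eq, Module.End.mul_apply,
      H.adjoint_apply_of_apply_eq_zero (H.apply_top w), map_zero]
  refine ⟨c • ((N * N') ^ i) w, ?_⟩
  rw [map_add, hs.apply_comm, map_smul, hs.apply_mul_pow H.commute, hw]
  simp only [map_add, map_smul, h2, smul_zero, add_zero]
  rw [h1]
  linear_combination (norm := module) c • H.add_self (N' (((N * N') ^ i) w))

theorem exists_fixed_add_fixed (H : IsOddBlock Q N N' j x z) {s t : End K V}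
    (hs : IsInverting Q N N' s) (ht : IsInverting Q N N' t) (hst : ∀ v, t v = s (v + N v))
    (htriv : ∀ v, ∃ w, s v = v + N w) (v : V) :
    ∃ a b y, s a = a ∧ t b = b ∧ v = a + b + N y := by
  rcases Nat.eq_zero_or_pos j with rfl | hj
  · have hN : N = 0 := by simpa using H.pow_eq_zero
    obtain ⟨w, hw⟩ := htriv v
    exact ⟨v, 0, 0, by simpa [hN] using hw, map_zero _, by simp⟩
  obtain ⟨w, hw⟩ := htriv v
  have h1 : N w + N' (s w) = 0 := by
    have h := congrArg s hw
    rw [hs.involutive, map_add, hs.apply_comm, hw, add_assoc] at h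
    exact left_eq_add.1 h
  have htw : t w = s w + N' (s w) := by rw [hst, map_add, hs.apply_comm]
  set u := t w - w with hu
  have hNu : N u = 0 := by
    rw [hu, map_sub, htw, map_add, ← H.apply_add_apply]
    linear_combination (norm := module) H.add_self (N (s w)) + h1 - H.add_self (N w)
  obtain ⟨y₁, hy₁⟩ := H.exists_fixed hj hs (w := v + w) (u := u)
    (by
      rw [map_add, hw, hu, htw]
      linear_combination (norm := module) H.add_self (N w) - h1) hNu
  obtain ⟨y₂, hy₂⟩ := H.exists_fixed hj ht (w := w) (u := u) (by rw [hu]; abel) hNu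
  refine ⟨_, _, -(y₁ + y₂), hy₁, hy₂, ?_⟩
  rw [map_neg, map_add]
  linear_combination (norm := module) -H.add_self w

end IsOddBlock

namespace IsOddBlock

variable {Q : QuadraticForm K V} {N N' : End K V} {j : ℕ} {x z : V}

theorem isInverting_mul (H : IsOddBlock Q N N' j x z) {s t : End K V}
    (hs : IsInverting Q N N' s) (hst : ∀ v, t v = s (v + N v)) : IsInverting Q N N' t where
  involutive v := by
    have h : s (v + N v) + N (s (v + N v)) = s v := by
      simp only [map_add, hs.apply_comm, ← H.apply_add_apply]
      linear_combination (norm := module) H.add_self (N (s v)) + H.add_self (N' (s v))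
    rw [hst, hst, h, hs.involutive]
  apply_comm v := by rw [hst, hst, ← map_add, hs.apply_comm]
  quad v := by
    have h : Q (v + N v) - Q v - Q (N v) = Q.polarBilin v (N v) := rfl
    rw [hst, hs.quad]
    linear_combination h + H.quad v + Q.polarBilin v (N v) * H.two

theorem exists_fixed_topForm_ne_zero (H : IsOddBlock Q N N' j x z) {s t : End K V}
    (hs : IsInverting Q N N' s) (hst : ∀ v, t v = s (v + N v))
    (htriv : ∀ v, ∃ w, s v = v + N w) :
    ∃ p q, (s p = p ∨ t p = p) ∧ (s q = q ∨ t q = q) ∧ topForm Q N N' j p q ≠ 0 := by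
  by_contra! h
  have hfix := H.exists_fixed_add_fixed hs (H.isInverting_mul hs hst) hst htriv
  obtain ⟨a, b, y, ha, hb, hx⟩ := hfix x
  obtain ⟨c, d, y', hc, hd, hz⟩ := hfix z
  refine H.topForm_generators_ne_zero ?_
  rw [hx, hz]
  simp [H.topForm_apply_left, H.topForm_apply_right, h a c (.inl ha) (.inl hc),
    h a d (.inl ha) (.inr hd), h b c (.inr hb) (.inl hc), h b d (.inr hb) (.inr hd)]

theorem cyclicSpan_invariant (H : IsOddBlock Q N N' j x z) {s t : End K V}
    (hs : IsInverting Q N N' s) (hst : ∀ v, t v = s (v + N v)) {p : V} (hp : s p = p ∨ t p = p) :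
    ∀ v ∈ cyclicSpan N p, s v ∈ cyclicSpan N p := by
  have hmem : s p ∈ cyclicSpan N p := by
    rcases hp with hp | hp
    · rw [hp]
      exact self_mem_cyclicSpan N p
    · rw [hst] at hp
      rw [← hp, hs.involutive, hp]
      exact add_mem (self_mem_cyclicSpan N p) (apply_mem_cyclicSpan (self_mem_cyclicSpan N p))
  refine cyclicSpan_le (P := (cyclicSpan N p).comap s) hmem fun v hv => ?_
  rw [Submodule.mem_comap, hs.apply_comm]
  exact H.adjoint_mem (fun _ => apply_mem_cyclicSpan) hv

theorem exists_isCompl_invariant [FiniteDimensional K V] (H : IsOddBlock Q N N' j x z)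
    {s : End K V} (hs : IsInverting Q N N' s) (htriv : ∀ v, ∃ w, s v = v + N w) :
    ∃ U W : Submodule K V, U ≠ ⊥ ∧ W ≠ ⊥ ∧ Invariant N U ∧ Invariant N W ∧
      Invariant s U ∧ Invariant s W ∧ IsCompl U W := by
  have hst : ∀ v, (s * (1 + N)) v = s (v + N v) := fun v => rfl
  obtain ⟨p, q, hp, hq, hpq⟩ := H.exists_fixed_topForm_ne_zero hs hst htriv
  have hne : ∀ p, p ≠ 0 → cyclicSpan N p ≠ ⊥ := fun p hp h =>
    hp ((Submodule.mem_bot K).1 (h ▸ self_mem_cyclicSpan N p))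
  refine ⟨cyclicSpan N p, cyclicSpan N q, hne p ?_, hne q ?_, fun _ => apply_mem_cyclicSpan,
    fun _ => apply_mem_cyclicSpan, H.cyclicSpan_invariant hs hst hp,
    H.cyclicSpan_invariant hs hst hq, H.isCompl_cyclicSpan hpq⟩
  · rintro rfl
    simp at hpq
  · rintro rfl
    simp at hpq

theorem topForm_apply_ne_zero (H : IsOddBlock Q N N' j x z) {s : End K V}
    (hs : IsInverting Q N N' s) {v : V} (hv : ∀ w, s v ≠ v + N w) :
    topForm Q N N' j v (s v) ≠ 0 := by
  intro h
  by_cases hvN : v ∈ LinearMap.range N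
  · obtain ⟨y, rfl⟩ := hvN
    have h1 : N' (s y) = N (N' (s y) - s y) := by
      rw [map_sub, ← H.apply_add_apply, add_sub_cancel_left]
    refine hv (N' (s y) - s y - y) ?_
    rw [hs.apply_comm, map_sub, ← h1]
    abel
  obtain ⟨w, hw⟩ := H.exists_topForm_ne_zero hvN
  obtain ⟨a, b, y, hy⟩ := H.span_of_topForm_ne_zero hw (s v)
  have hb : b = 0 := by
    rw [hy] at h
    simpa [H.topForm_self, H.topForm_apply_right, hw] using h
  rw [hb, zero_smul, add_zero] at hy
  have hy' : v = a • s v + N' (s y) := by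
    conv_lhs => rw [← hs.involutive v, hy, map_add, map_smul, hs.apply_comm]
  have ha : a * a = 1 := by
    have h1 : topForm Q N N' j v w = a * a * topForm Q N N' j v w := by
      conv_lhs => rw [hy', hy]
      have h2 : ∀ u u', topForm Q N N' j (N' u) u' = 0 := fun u u' => by
        rw [topForm_apply, H.top_apply', map_zero, LinearMap.zero_apply]
      simp only [map_add, map_smul, LinearMap.add_apply, LinearMap.smul_apply, smul_eq_mul,
        H.topForm_apply_left, h2, add_zero]
      ring
    exact (mul_eq_right₀ hw).1 h1.symm
  have ha1 : a = 1 := by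
    have h2 : (a - 1) * (a - 1) = 0 := by linear_combination ha + (1 - a) * H.two
    exact sub_eq_zero.1 (mul_self_eq_zero.1 h2)
  exact hv y (by rw [hy, ha1, one_smul])

theorem finrank_range_of_not_trivial [FiniteDimensional K V] (H : IsOddBlock Q N N' j x z)
    {s : End K V} (hs : IsInverting Q N N' s) {v : V} (hv : ∀ w, s v ≠ v + N w) :
    finrank K (LinearMap.range (s - LinearMap.id)) = 2 * j + 1 := by
  have hne := H.topForm_apply_ne_zero hs hv
  set E := cyclicSpan N v with hE
  have hEN : ∀ p ∈ E, N p ∈ E := fun _ => apply_mem_cyclicSpan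
  have htop : E ⊔ E.map s = ⊤ := by
    refine H.sup_eq_top hne (Submodule.mem_sup_left (self_mem_cyclicSpan N v))
      (Submodule.mem_sup_right ⟨v, self_mem_cyclicSpan N v, rfl⟩) fun u hu => ?_
    obtain ⟨a, ha, _, ⟨b, hb, rfl⟩, rfl⟩ := Submodule.mem_sup.1 hu
    rw [map_add, ← hs.apply_comm']
    exact Submodule.add_mem_sup (hEN _ ha) ⟨_, H.adjoint_mem hEN hb, rfl⟩
  have h1 := Submodule.finrank_sup_add_finrank_inf_eq E (E.map s)
  have h2 := finrank_cyclicSpan_le H.pow_eq_zero v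
  have h3 := Submodule.finrank_map_le s E
  rw [htop, finrank_top, H.finrank_eq] at h1
  rw [← hE] at h2
  have hinf : E ⊓ E.map s = ⊥ := Submodule.finrank_eq_zero.1 (by omega)
  have hker : E ⊓ LinearMap.ker (s - LinearMap.id) = ⊥ := by
    refine eq_bot_iff.2 fun p hp => ?_
    have hsp : s p = p := sub_eq_zero.1 hp.2
    exact hinf.le ⟨hp.1, p, hp.1, hsp⟩
  have hrange : LinearMap.range (s - LinearMap.id) = E.map (s - LinearMap.id) := by
    refine le_antisymm ?_ LinearMap.map_le_range
    rintro _ ⟨u, rfl⟩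
    have hu : u ∈ E ⊔ E.map s := htop ▸ Submodule.mem_top
    obtain ⟨a, ha, _, ⟨b, hb, rfl⟩, rfl⟩ := Submodule.mem_sup.1 hu
    refine ⟨a - b, sub_mem ha hb, ?_⟩
    simp only [LinearMap.sub_apply, LinearMap.id_apply, map_sub, map_add, hs.involutive]
    abel
  have h4 := finrank_map_add_finrank_inf_ker (s - LinearMap.id) E
  rw [hker, finrank_bot, ← hrange] at h4
  omega

theorem finrank_map_sub_id [FiniteDimensional K V] (H : IsOddBlock Q N N' j x z)
    {s : End K V} (hs : IsInverting Q N N' s) {U : Submodule K V} (hUN : Invariant N U)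
    (hUs : Invariant s U) (hU : finrank K U = 2 * j + 1)
    (hker : finrank K (U ⊓ LinearMap.ker N : Submodule K V) ≤ 1) :
    finrank K (U.map (s - LinearMap.id)) = j := by
  have hst : ∀ v, (s * (1 + N)) v = s (v + N v) := fun v => rfl
  set t := s * (1 + N)
  have hUt : Invariant t U := fun u hu => by
    rw [hst]
    exact hUs _ (add_mem hu (hUN u hu))
  have hle : ∀ r : End K V, IsInverting Q N N' r → Invariant r U →
      U.map (r - LinearMap.id) ≤ U ⊓ LinearMap.ker (r - LinearMap.id) := by
    rintro r hr hUr _ ⟨u, hu, rfl⟩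
    refine ⟨sub_mem (hUr u hu) hu, LinearMap.mem_ker.2 ?_⟩
    simp only [LinearMap.sub_apply, LinearMap.id_apply, map_sub, hr.involutive]
    linear_combination (norm := module) H.add_self u - H.add_self (r u)
  have h1 := Submodule.finrank_mono (hle s hs hUs)
  have h2 := Submodule.finrank_mono (hle t (H.isInverting_mul hs hst) hUt)
  have h3 := finrank_map_add_finrank_inf_ker (s - LinearMap.id) U
  have h4 := finrank_map_add_finrank_inf_ker (t - LinearMap.id) U
  have h5 := Submodule.finrank_sup_add_finrank_inf_eq (U ⊓ LinearMap.ker (s - LinearMap.id))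
    (U ⊓ LinearMap.ker (t - LinearMap.id))
  have h6 : finrank K (U ⊓ LinearMap.ker (s - LinearMap.id) ⊔
      U ⊓ LinearMap.ker (t - LinearMap.id) : Submodule K V) ≤ finrank K U :=
    Submodule.finrank_mono (sup_le inf_le_left inf_le_left)
  have h7 : U ⊓ LinearMap.ker (s - LinearMap.id) ⊓ (U ⊓ LinearMap.ker (t - LinearMap.id)) ≤
      U ⊓ LinearMap.ker N := by
    rintro u ⟨⟨hu, hsu⟩, -, htu⟩
    have hsu' : s u = u := sub_eq_zero.1 hsu
    have htu' : t u = u := sub_eq_zero.1 htu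
    rw [hst, map_add, hsu', add_eq_left] at htu'
    refine ⟨hu, LinearMap.mem_ker.2 ?_⟩
    rw [← hs.involutive (N u), htu', map_zero]
  have h8 := Submodule.finrank_mono h7
  omega

theorem one_le_finrank_inf_ker [FiniteDimensional K V] (H : IsOddBlock Q N N' j x z)
    {U : Submodule K V} (hUN : Invariant N U) (hU : U ≠ ⊥) :
    1 ≤ finrank K (U ⊓ LinearMap.ker N : Submodule K V) := by
  by_contra! h
  have h0 : U ⊓ LinearMap.ker N = ⊥ := Submodule.finrank_eq_zero.1 (by omega)
  obtain ⟨u, hu, hu0⟩ := Submodule.exists_mem_ne_zero_of_ne_bot hU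
  have hpow : ∀ i, (N ^ i) u ∈ U ∧ (N ^ i) u ≠ 0 := by
    intro i
    induction i with
    | zero => exact ⟨hu, hu0⟩
    | succ i ih =>
      rw [pow_succ', Module.End.mul_apply]
      exact ⟨hUN _ ih.1, fun h1 => ih.2 ((Submodule.mem_bot K).1 (h0 ▸ ⟨ih.1, h1⟩))⟩
  exact (hpow (2 * j + 1)).2 (by rw [H.pow_eq_zero, LinearMap.zero_apply])

theorem finrank_range_of_isCompl [FiniteDimensional K V] (H : IsOddBlock Q N N' j x z)
    {s : End K V} (hs : IsInverting Q N N' s) {U W : Submodule K V} (hU : U ≠ ⊥) (hW : W ≠ ⊥)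
    (hUN : Invariant N U) (hWN : Invariant N W) (hUs : Invariant s U) (hWs : Invariant s W)
    (hUW : IsCompl U W) : finrank K (LinearMap.range (s - LinearMap.id)) = 2 * j := by
  have h1 := H.one_le_finrank_inf_ker hUN hU
  have h2 := H.one_le_finrank_inf_ker hWN hW
  have h3 := Submodule.finrank_sup_add_finrank_inf_eq (U ⊓ LinearMap.ker N) (W ⊓ LinearMap.ker N)
  have h4 : finrank K (U ⊓ LinearMap.ker N ⊔ W ⊓ LinearMap.ker N : Submodule K V) ≤ 2 :=
    H.finrank_ker ▸ Submodule.finrank_mono (sup_le inf_le_right inf_le_right)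
  have h5 : U ⊓ LinearMap.ker N ⊓ (W ⊓ LinearMap.ker N) = ⊥ :=
    eq_bot_iff.2 ((inf_le_inf inf_le_left inf_le_left).trans hUW.inf_eq_bot.le)
  rw [h5, finrank_bot] at h3
  have h6 := finrank_le_of_finrank_inf_ker_le_one H.pow_eq_zero hUN (by omega)
  have h7 := finrank_le_of_finrank_inf_ker_le_one H.pow_eq_zero hWN (by omega)
  have h8 := Submodule.finrank_add_eq_of_isCompl hUW
  rw [H.finrank_eq] at h8
  have h9 := H.finrank_map_sub_id hs hUN hUs (by omega) (by omega)
  have h10 := H.finrank_map_sub_id hs hWN hWs (by omega) (by omega)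
  have hle : ∀ P : Submodule K V, Invariant s P → P.map (s - LinearMap.id) ≤ P := by
    rintro P hP _ ⟨p, hp, rfl⟩
    exact sub_mem (hP p hp) hp
  have h11 : U.map (s - LinearMap.id) ⊓ W.map (s - LinearMap.id) = ⊥ :=
    eq_bot_iff.2 ((inf_le_inf (hle U hUs) (hle W hWs)).trans hUW.inf_eq_bot.le)
  have h12 := Submodule.finrank_sup_add_finrank_inf_eq (U.map (s - LinearMap.id))
    (W.map (s - LinearMap.id))
  rw [h11, finrank_bot, ← Submodule.map_sup, hUW.sup_eq_top, Submodule.map_top] at h12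
  omega

end IsOddBlock

theorem exists_isOddBlock {Q : QuadraticForm K V} (hQ : Nondefective Q) (hchar : ringChar K = 2)
    {φ : V ≃ₗ[K] V} (hO : InO Q φ) (h1o : IsType1o Q φ.toLinearMap) :
    ∃ (j : ℕ) (x z : V), IsOddBlock Q (φ.toLinearMap - 1) ((φ⁻¹).toLinearMap - 1) j x z := by
  obtain ⟨m, ⟨-, -, hmin, x, z, hxz⟩, j, rfl⟩ := h1o
  have h2 : (2 : K) = 0 := by
    have := ringChar.Nat.cast_ringChar (R := K)
    rwa [hchar, Nat.cast_ofNat] at this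
  have hφφ : ∀ v, φ (φ⁻¹ v) = v := φ.apply_symm_apply
  have hφφ' : ∀ v, φ⁻¹ (φ v) = v := φ.symm_apply_apply
  have hpol : ∀ u v, Q.polarBilin (φ u) v = Q.polarBilin u (φ⁻¹ v) := fun u v => by
    conv_lhs => rw [← hφφ v]
    simp only [QuadraticMap.polarBilin_apply_apply, QuadraticMap.polar, ← map_add, hO (_)]
  have haeval : ∀ i, aeval φ.toLinearMap ((X - 1 : K[X]) ^ i) = (φ.toLinearMap - 1) ^ i := by
    simp
  refine ⟨j, x, z, h2, fun u hu => hQ u hu, fun u v => ?_, ?_, ?_, fun p => ?_, ?_, ?_,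
    fun v => ?_⟩
  · simp [-QuadraticMap.polarBilin_apply_apply, hpol]
  · ext v
    simp only [Module.End.mul_apply, LinearMap.sub_apply, LinearMap.add_apply, Module.End.one_apply,
      LinearEquiv.coe_coe, map_sub, hφφ]
    linear_combination (norm := module)
      2 • add_self_of_two_eq_zero h2 v - add_self_of_two_eq_zero h2 (φ⁻¹ v)
        - add_self_of_two_eq_zero h2 (φ v)
  · ext v
    simp only [Module.End.mul_apply, LinearMap.sub_apply, LinearMap.add_apply, Module.End.one_apply,
      LinearEquiv.coe_coe, map_sub, hφφ']
    linear_combination (norm := module)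
      2 • add_self_of_two_eq_zero h2 v - add_self_of_two_eq_zero h2 (φ⁻¹ v)
        - add_self_of_two_eq_zero h2 (φ v)
  · set q := (φ.toLinearMap - 1) p with hq
    have h : Q (p + q) - Q p - Q q = Q.polarBilin p q := rfl
    have hp : p + q = φ p := by simp [hq]
    rw [hp, hO] at h
    linear_combination -h - Q.polarBilin p q * h2
  · rw [← haeval, ← hmin, minpoly.aeval]
  · intro h
    rw [← haeval] at h
    have hdvd := minpoly.dvd K φ.toLinearMap h
    rw [hmin] at hdvd
    have hX : (X - 1 : K[X]) = X - C 1 := by simp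
    have := (pow_dvd_pow_iff (by rw [hX]; exact X_sub_C_ne_zero 1)
      (by rw [hX]; exact not_isUnit_X_sub_C 1)).1 hdvd
    omega
  · have hcyc : ∀ x, cyclicSpan φ.toLinearMap x ≤
        Submodule.span K {x} ⊔ LinearMap.range (φ.toLinearMap - 1) := fun x => by
      refine cyclicSpan_le (Submodule.mem_sup_left (Submodule.mem_span_singleton_self x))
        fun p hp => ?_
      have : φ.toLinearMap p = p + (φ.toLinearMap - 1) p := by simp
      rw [this]
      exact add_mem hp (Submodule.mem_sup_right ⟨p, rfl⟩)
    have hv : v ∈ cyclicSpan φ.toLinearMap x ⊔ cyclicSpan φ.toLinearMap z :=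
      hxz.sup_eq_top ▸ Submodule.mem_top
    obtain ⟨p, hp, q, hq, rfl⟩ := Submodule.mem_sup.1 hv
    obtain ⟨p₁, hp₁, _, ⟨y₁, rfl⟩, rfl⟩ := Submodule.mem_sup.1 (hcyc x hp)
    obtain ⟨q₁, hq₁, _, ⟨y₂, rfl⟩, rfl⟩ := Submodule.mem_sup.1 (hcyc z hq)
    obtain ⟨a, rfl⟩ := Submodule.mem_span_singleton.1 hp₁
    obtain ⟨b, rfl⟩ := Submodule.mem_span_singleton.1 hq₁
    refine ⟨a, b, y₁ + y₂, ?_⟩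
    rw [map_add]
    abel

theorem invariant_sub_one_iff {f : End K V} {U : Submodule K V} :
    Invariant (f - 1) U ↔ Invariant f U := by
  refine ⟨fun h u hu => ?_, fun h u hu => sub_mem (h u hu) hu⟩
  simpa using add_mem (h u hu) hu

end Helpers

theorem stmt12 [Field K] [AddCommGroup V] [Module K V] [FiniteDimensional K V]
    (Q : QuadraticForm K V) (hQ : Nondefective Q)
    (hchar : ringChar K = 2) (φ : V ≃ₗ[K] V) (hO : InO Q φ)
    (h1o : IsType1o Q φ.toLinearMap)
    (σ : V ≃ₗ[K] V) (hσO : InO Q σ) (hσ2 : σ * σ = 1) (hσφ : σ * φ * σ = φ⁻¹) :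
    (∃ U W : Submodule K V, U ≠ ⊥ ∧ W ≠ ⊥ ∧
        Invariant φ.toLinearMap U ∧ Invariant φ.toLinearMap W ∧
        Invariant σ.toLinearMap U ∧ Invariant σ.toLinearMap W ∧ IsCompl U W) ↔
      InSO Q σ := by
  obtain ⟨j, x, z, H⟩ := exists_isOddBlock hQ hchar hO h1o
  have hs : IsInverting Q (φ.toLinearMap - 1) ((φ⁻¹).toLinearMap - 1) σ.toLinearMap := by
    have hσσ : ∀ v, σ (σ v) = v := fun v => LinearEquiv.congr_fun hσ2 v
    refine ⟨hσσ, fun v => ?_, hσO⟩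
    have h : σ (φ (σ (σ v))) = φ⁻¹ (σ v) := LinearEquiv.congr_fun hσφ (σ v)
    rw [hσσ] at h
    simp [h]
  constructor
  · rintro ⟨U, W, hU, hW, hUφ, hWφ, hUσ, hWσ, hUW⟩
    refine ⟨hσO, ?_⟩
    rw [H.finrank_range_of_isCompl hs hU hW (invariant_sub_one_iff.2 hUφ)
      (invariant_sub_one_iff.2 hWφ) hUσ hWσ hUW]
    exact even_two_mul j
  · rintro ⟨-, heven⟩
    have htriv : ∀ v, ∃ w, σ.toLinearMap v = v + (φ.toLinearMap - 1) w := by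
      by_contra! h
      obtain ⟨v, hv⟩ := h
      rw [H.finrank_range_of_not_trivial hs hv] at heven
      exact Nat.not_even_two_mul_add_one j heven
    obtain ⟨U, W, hU, hW, hUN, hWN, hUσ, hWσ, hUW⟩ := H.exists_isCompl_invariant hs htriv
    exact ⟨U, W, hU, hW, invariant_sub_one_iff.1 hUN, invariant_sub_one_iff.1 hWN, hUσ, hWσ, hUW⟩
end
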